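/- arXiv:1509.07714 — 7 statements merged into one kernel-verified Lean document; each statement's English description precedes it below -/
import Mathlib

section
/- The following four statements are equivalent: (1) −1 (mod n) lies in W_{d/2}; (2) (n₁−1)(n₂−1)/d² is even; (3) either n₁ ≡ 1 (mod 2d) and n₂ ≡ d+1 (mod 2d), or n₁ ≡ d+1 (mod 2d) and n₂ ≡ 1 (mod 2d); (4) n₁n₂ ≡ d+1 (mod 2d). -/
theorem ZMod.pow_eq_neg_one_iff_modEq {p : ℕ} [Fact p.Prime] (hp : Odd p) {x : ZMod p}
    (hx : orderOf x = p - 1) (k : ℕ) :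
    x ^ k = -1 ↔ k ≡ (p - 1) / 2 [MOD p - 1] := by
  have h2 := (Fact.out : p.Prime).two_le
  obtain ⟨m, rfl⟩ := hp
  have hm : 2 * m + 1 - 1 = 2 * m := by omega
  have hm' : 2 * m / 2 = m := by omega
  rw [hm] at hx ⊢
  rw [hm']
  have hsq : (x ^ m) ^ 2 = 1 := by
    rw [← pow_mul]
    exact orderOf_dvd_iff_pow_eq_one.mp (by rw [hx, mul_comm])
  have hne : x ^ m ≠ 1 := fun h => by
    have := Nat.le_of_dvd (by omega) (orderOf_dvd_of_pow_eq_one h)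
    omega
  have hfin : IsOfFinOrder x := orderOf_pos_iff.mp (by omega)
  rw [← (sq_eq_one_iff.mp hsq).resolve_left hne, hfin.pow_eq_pow_iff_modEq, hx]

theorem ZMod.natCast_eq_neg_one_iff_of_coprime {m n : ℕ} (h : m.Coprime n) (a : ℕ) :
    (a : ZMod (m * n)) = -1 ↔ (a : ZMod m) = -1 ∧ (a : ZMod n) = -1 := by
  have key (k : ℕ) : (a : ZMod k) = -1 ↔ k ∣ a + 1 := by
    rw [← ZMod.natCast_eq_zero_iff, Nat.cast_add_one, eq_neg_iff_add_eq_zero]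
  rw [key, key, key]
  exact ⟨fun h' => ⟨dvd_of_mul_right_dvd h', dvd_of_mul_left_dvd h'⟩,
    fun h' => h.mul_dvd_of_dvd_of_dvd h'.1 h'.2⟩

theorem Nat.exists_lt_lcm_modEq_iff {m n : ℕ} (hm : m ≠ 0) (hn : n ≠ 0) (a b : ℕ) :
    (∃ k < m.lcm n, k ≡ a [MOD m] ∧ k ≡ b [MOD n]) ↔ a ≡ b [MOD m.gcd n] := by
  constructor
  · rintro ⟨k, -, ha, hb⟩
    exact (ha.of_dvd (Nat.gcd_dvd_left m n)).symm.trans (hb.of_dvd (Nat.gcd_dvd_right m n))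
  · intro h
    exact ⟨Nat.chineseRemainder' h, Nat.chineseRemainder'_lt_lcm h hm hn,
      (Nat.chineseRemainder' h).2⟩

theorem Nat.mul_add_one_modEq_one_iff {d : ℕ} (hd : 0 < d) (a : ℕ) :
    d * a + 1 ≡ 1 [MOD 2 * d] ↔ Even a := by
  rw [mul_comm 2 d]
  change d * a + 1 ≡ d * 0 + 1 [MOD d * 2] ↔ _
  rw [Nat.ModEq.add_iff_right rfl, Nat.ModEq.mul_left_cancel_iff' hd.ne', Nat.even_iff]
  rfl

theorem Nat.mul_add_one_modEq_add_one_iff {d : ℕ} (hd : 0 < d) (a : ℕ) :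
    d * a + 1 ≡ d + 1 [MOD 2 * d] ↔ Odd a := by
  rw [mul_comm 2 d, show d + 1 = d * 1 + 1 by rw [mul_one], Nat.ModEq.add_iff_right rfl,
    Nat.ModEq.mul_left_cancel_iff' hd.ne', Nat.odd_iff]
  rfl

theorem stmt_0
    (n₁ n₂ d n e g u : ℕ)
    (hp₁ : n₁.Prime) (hp₂ : n₂.Prime)
    (hodd₁ : Odd n₁) (hodd₂ : Odd n₂) (hne : n₁ ≠ n₂)
    (hd : d = Nat.gcd (n₁ - 1) (n₂ - 1))
    (hn : n = n₁ * n₂)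
    (he : e = (n₁ - 1) * (n₂ - 1) / d)
    (hg₁ : orderOf (g : ZMod n₁) = n₁ - 1)
    (hg₂ : orderOf (g : ZMod n₂) = n₂ - 1)
    (hu₁ : (u : ZMod n₁) = (g : ZMod n₁))
    (hu₂ : (u : ZMod n₂) = 1)
    (W : ℕ → Set (ZMod n))
    (hW : ∀ i, W i = {x | ∃ s < e, x = (g : ZMod n) ^ s * (u : ZMod n) ^ i}) :
    List.TFAE [(-1 : ZMod n) ∈ W (d / 2),
      Even ((n₁ - 1) * (n₂ - 1) / d ^ 2),
      (n₁ ≡ 1 [MOD 2 * d] ∧ n₂ ≡ d + 1 [MOD 2 * d]) ∨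
        (n₁ ≡ d + 1 [MOD 2 * d] ∧ n₂ ≡ 1 [MOD 2 * d]),
      n₁ * n₂ ≡ d + 1 [MOD 2 * d]] := by
  obtain ⟨a, b, hab, ha, hb⟩ : ∃ a b, a.Coprime b ∧ n₁ - 1 = d * a ∧ n₂ - 1 = d * b := by
    obtain ⟨a, b, hab, ha, hb⟩ := Nat.exists_coprime (n₁ - 1) (n₂ - 1)
    exact ⟨a, b, hab, by rw [ha, hd, mul_comm], by rw [hb, hd, mul_comm]⟩
  have h₁ := hp₁.two_le
  have h₂ := hp₂.two_le
  have hd0 : 0 < d := Nat.pos_of_ne_zero fun h => by simp [h] at ha; omega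
  have ha0 : a ≠ 0 := fun h => by simp [h] at ha; omega
  have hn₁ : n₁ = d * a + 1 := by omega
  have hn₂ : n₂ = d * b + 1 := by omega
  obtain ⟨c, rfl⟩ : 2 ∣ d := by
    rw [hd]
    exact Nat.dvd_gcd (Nat.Odd.sub_odd hodd₁ odd_one).two_dvd
      (Nat.Odd.sub_odd hodd₂ odd_one).two_dvd
  have hc0 : c ≠ 0 := by omega
  have hnot : ¬(Even a ∧ Even b) := fun h => by
    have := Nat.dvd_gcd h.1.two_dvd h.2.two_dvd
    rw [hab] at this
    omega
  have hquot : (n₁ - 1) * (n₂ - 1) / (2 * c) ^ 2 = a * b := by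
    rw [ha, hb, show 2 * c * a * (2 * c * b) = (2 * c) ^ 2 * (a * b) by ring,
      Nat.mul_div_cancel_left _ (by positivity)]
  have hmem : (-1 : ZMod n) ∈ W (2 * c / 2) ↔ Odd (a + b) := by
    have := Fact.mk hp₁
    have := Fact.mk hp₂
    obtain ⟨a, rfl⟩ := Nat.exists_eq_succ_of_ne_zero ha0
    have hpt (s : ℕ) : (-1 : ZMod n) = (g : ZMod n) ^ s * (u : ZMod n) ^ c ↔
        s ≡ c * a [MOD n₁ - 1] ∧ s ≡ c * b [MOD n₂ - 1] := by
      subst hn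
      have := ZMod.natCast_eq_neg_one_iff_of_coprime
        ((Nat.coprime_primes hp₁ hp₂).mpr hne) (g ^ s * u ^ c)
      push_cast at this
      rw [eq_comm, this, hu₁, hu₂, one_pow, mul_one, ← pow_add,
        ZMod.pow_eq_neg_one_iff_modEq hodd₁ hg₁, ZMod.pow_eq_neg_one_iff_modEq hodd₂ hg₂,
        show (n₁ - 1) / 2 = c * a + c by
          rw [ha, mul_assoc, Nat.mul_div_cancel_left _ two_pos]
          rfl,
        show (n₂ - 1) / 2 = c * b by rw [hb, mul_assoc, Nat.mul_div_cancel_left _ two_pos],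
        Nat.ModEq.add_iff_right rfl]
    have hlcm : e = (n₁ - 1).lcm (n₂ - 1) := by rw [he, hd, Nat.lcm]
    rw [hW, Nat.mul_div_cancel_left _ two_pos, Set.mem_ofPred_eq]
    simp only [hpt]
    rw [hlcm, Nat.exists_lt_lcm_modEq_iff (by omega) (by omega), ← hd, mul_comm 2 c,
      Nat.ModEq.mul_left_cancel_iff' hc0, Nat.odd_iff, Nat.ModEq]
    omega
  have hprod : n₁ * n₂ ≡ 2 * c + 1 [MOD 2 * (2 * c)] ↔ Odd (a + b) := by
    rw [hn₁, hn₂, show (2 * c * a + 1) * (2 * c * b + 1) =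
      2 * c * (2 * (c * a * b) + (a + b)) + 1 by ring,
      Nat.mul_add_one_modEq_add_one_iff hd0]
    simp [Nat.odd_iff, Nat.add_mod]
  rw [hmem, hquot, hprod, hn₁, hn₂]
  simp only [Nat.mul_add_one_modEq_one_iff hd0, Nat.mul_add_one_modEq_add_one_iff hd0,
    Nat.even_mul, ← Nat.not_even_iff_odd, Nat.even_add]
  tfae_have 1 ↔ 2 := by tauto
  tfae_have 1 ↔ 3 := by tauto
  tfae_have 1 ↔ 4 := Iff.rfl
  tfae_finish
end

section
/- Let M = ((n₁−2)(n₂−2)−1)/6 and let D₀ + w denote {t + w : t ∈ D₀} in ℤ/nℤ. If (n₁−1)(n₂−1)/36 is even, then for every w in the unit group (ℤ/nℤ)*: |D₁ ∩ (D₀ + w)| = (3M−1)/2 when w ∈ D₀, and |D₁ ∩ (D₀ + w)| = (3M+1)/2 when w ∈ D₁. If (n₁−1)(n₂−1)/36 is odd, then |D₁ ∩ (D₀ + w)| = 3M/2 for every w ∈ (ℤ/nℤ)*. -/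
open Finset in
theorem sum_quadraticChar_mul_sub {F : Type*} [Field F] [Fintype F] [DecidableEq F]
    (hF : ringChar F ≠ 2) {w : F} (hw : w ≠ 0) :
    ∑ x, quadraticChar F x * quadraticChar F (x - w) = -1 := by
  have h := jacobiSum_nontrivial_inv (quadraticChar_ne_one hF)
  rw [(quadraticChar_isQuadratic F).inv, jacobiSum] at h
  have hneg : quadraticChar F (-1) * quadraticChar F (-1) = 1 := by
    rw [← pow_two, quadraticChar_sq_one (neg_ne_zero.mpr one_ne_zero)]
  have hww : quadraticChar F w * quadraticChar F w = 1 := by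
    rw [← pow_two, quadraticChar_sq_one hw]
  rw [← Equiv.sum_comp (Equiv.mulLeft₀ w hw)]
  have hterm : ∀ x : F, quadraticChar F (Equiv.mulLeft₀ w hw x) *
      quadraticChar F (Equiv.mulLeft₀ w hw x - w) =
      quadraticChar F (-1) * (quadraticChar F x * quadraticChar F (1 - x)) := fun x ↦ by
    have : Equiv.mulLeft₀ w hw x - w = w * (-1 * (1 - x)) := by
      rw [Equiv.mulLeft₀_apply]; ring
    rw [this, Equiv.mulLeft₀_apply]
    simp only [map_mul]
    linear_combination (quadraticChar F x * quadraticChar F (-1) * quadraticChar F (1 - x)) * hww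
  rw [sum_congr rfl fun x _ ↦ hterm x, ← mul_sum, h]
  linear_combination -hneg

theorem quadraticChar_sq_eq_ite {F : Type*} [Field F] [Fintype F] [DecidableEq F] (x : F) :
    quadraticChar F x ^ 2 = if x = 0 then 0 else 1 := by
  split_ifs with h
  · simp [h]
  · exact quadraticChar_sq_one h

open Finset in
theorem sum_quadraticChar_mul_sq_sub {F : Type*} [Field F] [Fintype F] [DecidableEq F]
    (hF : ringChar F ≠ 2) (w : F) :
    ∑ x, quadraticChar F x * quadraticChar F (x - w) ^ 2 = -quadraticChar F w := by
  have hterm : ∀ x : F, quadraticChar F x * quadraticChar F (x - w) ^ 2 =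
      quadraticChar F x - if x = w then quadraticChar F x else 0 := fun x ↦ by
    rw [quadraticChar_sq_eq_ite]
    simp only [sub_eq_zero]
    split_ifs <;> ring
  rw [sum_congr rfl fun x _ ↦ hterm x, sum_sub_distrib, quadraticChar_sum_zero hF, sum_ite_eq',
    if_pos (mem_univ w), zero_sub]

open Finset in
theorem sum_sq_quadraticChar_mul_sub {F : Type*} [Field F] [Fintype F] [DecidableEq F]
    (hF : ringChar F ≠ 2) (w : F) :
    ∑ x, quadraticChar F x ^ 2 * quadraticChar F (x - w) = -quadraticChar F (-w) := by
  rw [← Equiv.sum_comp (Equiv.addRight w), ← sum_quadraticChar_mul_sq_sub hF]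
  exact sum_congr rfl fun x _ ↦ by simp [mul_comm]

open Finset in
theorem sum_sq_quadraticChar_mul_sq_sub {F : Type*} [Field F] [Fintype F] [DecidableEq F]
    {w : F} (hw : w ≠ 0) :
    ∑ x, quadraticChar F x ^ 2 * quadraticChar F (x - w) ^ 2 = Fintype.card F - 2 := by
  have hterm : ∀ x : F, quadraticChar F x ^ 2 * quadraticChar F (x - w) ^ 2 =
      1 - (if x = 0 then 1 else 0) - if x = w then 1 else 0 := fun x ↦ by
    rw [quadraticChar_sq_eq_ite, quadraticChar_sq_eq_ite]
    simp only [sub_eq_zero]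
    split_ifs with h₀ h₁
    · exact absurd (h₁.symm.trans h₀) hw
    all_goals norm_num
  simp only [hterm, sum_sub_distrib, sum_ite_eq', mem_univ, if_true, sum_const, card_univ]
  simp
  ring

/-- The product of the quadratic characters of two finite fields. -/
def prodQuadraticChar (F₁ F₂ : Type*) [Field F₁] [Fintype F₁] [DecidableEq F₁]
    [Field F₂] [Fintype F₂] [DecidableEq F₂] (x : F₁ × F₂) : ℤ :=
  quadraticChar F₁ x.1 * quadraticChar F₂ x.2

open Finset in
theorem four_mul_card_prodQuadraticChar {F₁ F₂ : Type*} [Field F₁] [Fintype F₁] [DecidableEq F₁]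
    [Field F₂] [Fintype F₂] [DecidableEq F₂] (h₁ : ringChar F₁ ≠ 2) (h₂ : ringChar F₂ ≠ 2)
    {w : F₁ × F₂} (hw₁ : w.1 ≠ 0) (hw₂ : w.2 ≠ 0) :
    4 * (#{x : F₁ × F₂ | prodQuadraticChar F₁ F₂ x = -1 ∧
        prodQuadraticChar F₁ F₂ (x - w) = 1} : ℤ) =
      ((Fintype.card F₁ : ℤ) - 2) * (Fintype.card F₂ - 2) - 1
        + prodQuadraticChar F₁ F₂ (-w) - prodQuadraticChar F₁ F₂ w := by
  have hterm : ∀ x : F₁ × F₂,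
      (if prodQuadraticChar F₁ F₂ x = -1 ∧ prodQuadraticChar F₁ F₂ (x - w) = 1
        then (4 : ℤ) else 0) =
      (prodQuadraticChar F₁ F₂ x ^ 2 - prodQuadraticChar F₁ F₂ x) *
        (prodQuadraticChar F₁ F₂ (x - w) ^ 2 + prodQuadraticChar F₁ F₂ (x - w)) := fun x ↦ by
    have hval : ∀ y : F₁ × F₂, prodQuadraticChar F₁ F₂ y = 0 ∨ prodQuadraticChar F₁ F₂ y = 1 ∨
        prodQuadraticChar F₁ F₂ y = -1 := fun y ↦ by
      rcases quadraticChar_isQuadratic F₁ y.1 with h | h | h <;>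
        rcases quadraticChar_isQuadratic F₂ y.2 with h' | h' | h' <;>
        simp [prodQuadraticChar, h, h']
    rcases hval x with h | h | h <;> rcases hval (x - w) with h' | h' | h' <;> simp [h, h']
  have hcard : 4 * (#{x : F₁ × F₂ | prodQuadraticChar F₁ F₂ x = -1 ∧
        prodQuadraticChar F₁ F₂ (x - w) = 1} : ℤ) =
      ∑ x : F₁ × F₂, if prodQuadraticChar F₁ F₂ x = -1 ∧ prodQuadraticChar F₁ F₂ (x - w) = 1
        then (4 : ℤ) else 0 := by
    rw [← sum_filter, sum_const, nsmul_eq_mul, mul_comm]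
  rw [hcard, sum_congr rfl fun x _ ↦ hterm x]
  have hexpand : ∀ x : F₁ × F₂,
      (prodQuadraticChar F₁ F₂ x ^ 2 - prodQuadraticChar F₁ F₂ x) *
        (prodQuadraticChar F₁ F₂ (x - w) ^ 2 + prodQuadraticChar F₁ F₂ (x - w)) =
      (quadraticChar F₁ x.1 ^ 2 * quadraticChar F₁ (x.1 - w.1) ^ 2) *
          (quadraticChar F₂ x.2 ^ 2 * quadraticChar F₂ (x.2 - w.2) ^ 2)
        + (quadraticChar F₁ x.1 ^ 2 * quadraticChar F₁ (x.1 - w.1)) *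
          (quadraticChar F₂ x.2 ^ 2 * quadraticChar F₂ (x.2 - w.2))
        - (quadraticChar F₁ x.1 * quadraticChar F₁ (x.1 - w.1) ^ 2) *
          (quadraticChar F₂ x.2 * quadraticChar F₂ (x.2 - w.2) ^ 2)
        - (quadraticChar F₁ x.1 * quadraticChar F₁ (x.1 - w.1)) *
          (quadraticChar F₂ x.2 * quadraticChar F₂ (x.2 - w.2)) := fun x ↦ by
    simp only [prodQuadraticChar, Prod.fst_sub, Prod.snd_sub]
    ring
  rw [sum_congr rfl fun x _ ↦ hexpand x, sum_sub_distrib, sum_sub_distrib, sum_add_distrib]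
  simp only [Fintype.sum_prod_type, ← mul_sum, ← sum_mul]
  rw [sum_sq_quadraticChar_mul_sq_sub hw₁, sum_sq_quadraticChar_mul_sq_sub hw₂,
    sum_sq_quadraticChar_mul_sub h₁, sum_sq_quadraticChar_mul_sub h₂,
    sum_quadraticChar_mul_sq_sub h₁, sum_quadraticChar_mul_sq_sub h₂,
    sum_quadraticChar_mul_sub h₁ hw₁, sum_quadraticChar_mul_sub h₂ hw₂]
  simp only [prodQuadraticChar, Prod.fst_neg, Prod.snd_neg]
  ring

theorem quadraticChar_eq_neg_one_of_orderOf_eq {F : Type*} [Field F] [Fintype F] [DecidableEq F]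
    (hF : ringChar F ≠ 2) {g : F} (hg : orderOf g = Fintype.card F - 1) :
    quadraticChar F g = -1 := by
  have hcard := FiniteField.odd_card_of_char_ne_two hF
  have hone := Fintype.one_lt_card (α := F)
  have hg0 : g ≠ 0 := by
    rintro rfl
    rw [orderOf_zero] at hg
    omega
  rw [quadraticChar_eq_pow_of_char_ne_two hF hg0, if_neg]
  intro h
  have := Nat.le_of_dvd (by omega) (orderOf_dvd_of_pow_eq_one h)
  omega

theorem exists_pow_eq_of_orderOf_eq {F : Type*} [Field F] [Fintype F] {g : F}
    (hg : orderOf g = Fintype.card F - 1) {x : F} (hx : x ≠ 0) : ∃ k : ℕ, g ^ k = x := by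
  have hone := Fintype.one_lt_card (α := F)
  have : NeZero (Fintype.card F - 1) := ⟨by omega⟩
  obtain ⟨k, -, hk⟩ := (hg ▸ IsPrimitiveRoot.orderOf g).eq_pow_of_pow_eq_one
    (FiniteField.pow_card_sub_one_eq_one x hx)
  exact ⟨k, hk⟩

theorem exists_pow_eq_pow_add_and_pow_eq_pow {M N : Type*} [Monoid M] [Monoid N] {g : M} {h : N} {d : ℕ}
    (hd : d = Nat.gcd (orderOf g) (orderOf h)) (hg : orderOf g ≠ 0) (hh : orderOf h ≠ 0)
    (a b : ℕ) :
    ∃ s < Nat.lcm (orderOf g) (orderOf h), ∃ i < d, g ^ a = g ^ (s + i) ∧ h ^ b = h ^ s := by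
  have hd0 : 0 < d := hd ▸ Nat.gcd_pos_of_pos_left _ (Nat.pos_of_ne_zero hg)
  -- `i ≡ a - b` modulo `d`, and `c ≡ a - i` modulo `orderOf g`
  obtain ⟨i, hid, hbi⟩ : ∃ i < d, b + i ≡ a [MOD d] := by
    refine ⟨(a + (d - 1) * b) % d, Nat.mod_lt _ hd0, ?_⟩
    have h₁ : b + (a + (d - 1) * b) % d ≡ b + (a + (d - 1) * b) [MOD d] :=
      (Nat.mod_modEq _ _).add_left _
    have h₂ : b + (a + (d - 1) * b) = a + d * b := by
      obtain ⟨m, rfl⟩ := Nat.exists_eq_add_of_le' hd0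
      rw [Nat.add_sub_cancel]
      ring
    rw [h₂] at h₁
    exact h₁.trans (by simp [Nat.ModEq])
  obtain ⟨c, hci⟩ : ∃ c, c + i ≡ a [MOD orderOf g] := by
    refine ⟨a + (orderOf g - 1) * i, ?_⟩
    have : a + (orderOf g - 1) * i + i = a + orderOf g * i := by
      obtain ⟨m, hm⟩ := Nat.exists_eq_add_of_le' (Nat.pos_of_ne_zero hg)
      rw [hm, Nat.add_sub_cancel]
      ring
    rw [this]
    simp [Nat.ModEq]
  have hcb : c ≡ b [MOD Nat.gcd (orderOf g) (orderOf h)] :=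
    Nat.ModEq.add_right_cancel' i
      ((hci.of_dvd (Nat.gcd_dvd_left _ _)).trans (hd ▸ hbi).symm)
  obtain ⟨s, hs, hsc, hsb⟩ : ∃ s < Nat.lcm (orderOf g) (orderOf h),
      s ≡ c [MOD orderOf g] ∧ s ≡ b [MOD orderOf h] :=
    ⟨_, Nat.chineseRemainder'_lt_lcm hcb hg hh, (Nat.chineseRemainder' hcb).2⟩
  exact ⟨s, hs, i, hid, pow_eq_pow_of_modEq (hci.symm.trans (hsc.symm.add_right i))
    (pow_orderOf_eq_one g), pow_eq_pow_of_modEq hsb.symm (pow_orderOf_eq_one h)⟩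

theorem quadraticChar_neg_one_of_card_eq {F : Type*} [Field F] [Fintype F] [DecidableEq F]
    (hF : ringChar F ≠ 2) {a : ℕ} (ha : Fintype.card F = 6 * a + 1) :
    quadraticChar F (-1) = (-1) ^ a := by
  rw [quadraticChar_neg_one hF, ha]
  rcases Nat.even_or_odd a with h | h
  · rw [h.neg_one_pow, ZMod.χ₄_nat_one_mod_four]
    obtain ⟨k, rfl⟩ := h
    omega
  · rw [h.neg_one_pow, ZMod.χ₄_nat_three_mod_four]
    obtain ⟨k, rfl⟩ := h
    omega

theorem stmt_3
    (n₁ n₂ n e g u : ℕ)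
    (hp₁ : n₁.Prime) (hp₂ : n₂.Prime)
    (hodd₁ : Odd n₁) (hodd₂ : Odd n₂) (hne : n₁ ≠ n₂)
    (h6 : Nat.gcd (n₁ - 1) (n₂ - 1) = 6)
    (hn : n = n₁ * n₂)
    (he : e = (n₁ - 1) * (n₂ - 1) / 6)
    (hg₁ : orderOf (g : ZMod n₁) = n₁ - 1)
    (hg₂ : orderOf (g : ZMod n₂) = n₂ - 1)
    (hu₁ : (u : ZMod n₁) = (g : ZMod n₁))
    (hu₂ : (u : ZMod n₂) = 1)
    (W : ℕ → Set (ZMod n))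
    (hW : ∀ i, W i = {x | ∃ s < e, x = (g : ZMod n) ^ s * (u : ZMod n) ^ i})
    (D₀ D₁ : Set (ZMod n))
    (hD₀ : D₀ = W 0 ∪ W 2 ∪ W 4) (hD₁ : D₁ = W 1 ∪ W 3 ∪ W 5)
    (M : ℕ) (hM : M = ((n₁ - 2) * (n₂ - 2) - 1) / 6) :
    (Even ((n₁ - 1) * (n₂ - 1) / 36) →
      ∀ w : ZMod n, IsUnit w →
        (w ∈ D₀ → 2 * (D₁ ∩ ((· + w) '' D₀)).ncard = 3 * M - 1) ∧
        (w ∈ D₁ → 2 * (D₁ ∩ ((· + w) '' D₀)).ncard = 3 * M + 1)) ∧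
    (Odd ((n₁ - 1) * (n₂ - 1) / 36) →
      ∀ w : ZMod n, IsUnit w →
        2 * (D₁ ∩ ((· + w) '' D₀)).ncard = 3 * M) := by
  subst hn
  have : Fact n₁.Prime := ⟨hp₁⟩
  have : Fact n₂.Prime := ⟨hp₂⟩
  have hr₁ : ringChar (ZMod n₁) ≠ 2 := by
    rw [ZMod.ringChar_zmod_n]; rintro rfl; exact absurd hodd₁ (by decide)
  have hr₂ : ringChar (ZMod n₂) ≠ 2 := by
    rw [ZMod.ringChar_zmod_n]; rintro rfl; exact absurd hodd₂ (by decide)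
  obtain ⟨a, ha⟩ : 6 ∣ n₁ - 1 := h6 ▸ Nat.gcd_dvd_left _ _
  obtain ⟨b, hb⟩ : 6 ∣ n₂ - 1 := h6 ▸ Nat.gcd_dvd_right _ _
  have hn₁ : n₁ = 6 * a + 1 := by have := hp₁.one_lt; omega
  have hn₂ : n₂ = 6 * b + 1 := by have := hp₂.one_lt; omega
  have ha0 : 0 < a := by have := hp₁.one_lt; omega
  have hb0 : 0 < b := by have := hp₂.one_lt; omega
  have hab : Nat.gcd a b = 1 := by
    rw [ha, hb, Nat.gcd_mul_left] at h6
    omega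
  have hdiv : (n₁ - 1) * (n₂ - 1) / 36 = a * b := by
    rw [ha, hb, show 6 * a * (6 * b) = a * b * 36 by ring]
    exact Nat.mul_div_cancel _ (by norm_num)
  have hlcm : e = Nat.lcm (orderOf (g : ZMod n₁)) (orderOf (g : ZMod n₂)) := by
    rw [he, hg₁, hg₂, Nat.lcm, h6]
  have hg₁' : quadraticChar (ZMod n₁) g = -1 :=
    quadraticChar_eq_neg_one_of_orderOf_eq hr₁ (by rw [hg₁, ZMod.card])
  have hg₂' : quadraticChar (ZMod n₂) g = -1 :=
    quadraticChar_eq_neg_one_of_orderOf_eq hr₂ (by rw [hg₂, ZMod.card])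
  let c := ZMod.chineseRemainder ((Nat.coprime_primes hp₁ hp₂).mpr hne)
  let χ : ZMod (n₁ * n₂) → ℤ := fun x ↦ prodQuadraticChar (ZMod n₁) (ZMod n₂) (c x)
  have hcW : ∀ s i : ℕ, c ((g : ZMod (n₁ * n₂)) ^ s * (u : ZMod (n₁ * n₂)) ^ i) =
      ((g : ZMod n₁) ^ (s + i), (g : ZMod n₂) ^ s) := fun s i ↦ by
    rw [map_mul, map_pow, map_pow, map_natCast, map_natCast]
    ext
    · simp [hu₁, pow_add]
    · simp [hu₂]
  have hχW : ∀ i, ∀ x ∈ W i, χ x = (-1) ^ i := fun i x hx ↦ by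
    rw [hW] at hx
    obtain ⟨s, -, rfl⟩ := hx
    simp only [χ, hcW, prodQuadraticChar, map_pow, hg₁', hg₂']
    rw [pow_add, mul_right_comm, ← mul_pow]
    simp
  have hcover : ∀ x, χ x ≠ 0 → ∃ i < 6, x ∈ W i := fun x hx ↦ by
    have hx₁ : (c x).1 ≠ 0 := fun h ↦ hx (by simp [χ, prodQuadraticChar, h])
    have hx₂ : (c x).2 ≠ 0 := fun h ↦ hx (by simp [χ, prodQuadraticChar, h])
    obtain ⟨k, hk⟩ := exists_pow_eq_of_orderOf_eq (by rw [hg₁, ZMod.card]) hx₁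
    obtain ⟨l, hl⟩ := exists_pow_eq_of_orderOf_eq (by rw [hg₂, ZMod.card]) hx₂
    obtain ⟨s, hs, i, hi, h₁, h₂⟩ := exists_pow_eq_pow_add_and_pow_eq_pow
      (g := (g : ZMod n₁)) (h := (g : ZMod n₂)) (d := 6)
      (by rw [hg₁, hg₂, h6]) (by omega) (by omega) k l
    refine ⟨i, hi, ?_⟩
    rw [hW]
    refine ⟨s, hlcm ▸ hs, c.injective ?_⟩
    rw [hcW, ← h₁, ← h₂, hk, hl]
  have hD₀χ : ∀ x, x ∈ D₀ ↔ χ x = 1 := fun x ↦ by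
    rw [hD₀]
    constructor
    · rintro ((h | h) | h) <;> simpa using hχW _ x h
    · intro h
      obtain ⟨i, hi, hx⟩ := hcover x (by rw [h]; norm_num)
      have hs := hχW i x hx
      rw [h] at hs
      interval_cases i <;> first | (norm_num at hs; done) | simp [hx]
  have hD₁χ : ∀ x, x ∈ D₁ ↔ χ x = -1 := fun x ↦ by
    rw [hD₁]
    constructor
    · rintro ((h | h) | h) <;> simpa using hχW _ x h
    · intro h
      obtain ⟨i, hi, hx⟩ := hcover x (by rw [h]; norm_num)
      have hs := hχW i x hx
      rw [h] at hs
      interval_cases i <;> first | (norm_num at hs; done) | simp [hx]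
  have hχneg : ∀ x, χ (-x) = (-1) ^ (a + b) * χ x := fun x ↦ by
    simp only [χ, prodQuadraticChar, map_neg, Prod.fst_neg, Prod.snd_neg]
    rw [neg_eq_neg_one_mul (c x).1, neg_eq_neg_one_mul (c x).2, map_mul, map_mul,
      quadraticChar_neg_one_of_card_eq hr₁ (by rw [ZMod.card, hn₁]),
      quadraticChar_neg_one_of_card_eq hr₂ (by rw [ZMod.card, hn₂])]
    ring
  have hM' : (6 * M : ℤ) = ((n₁ : ℤ) - 2) * (n₂ - 2) - 1 := by
    obtain ⟨a, rfl⟩ := Nat.exists_eq_add_of_le' ha0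
    obtain ⟨b, rfl⟩ := Nat.exists_eq_add_of_le' hb0
    have h₁ : n₁ - 2 = 6 * a + 5 := by omega
    have h₂ : n₂ - 2 = 6 * b + 5 := by omega
    have : M = 6 * a * b + 5 * a + 5 * b + 4 := by
      rw [hM, h₁, h₂, show (6 * a + 5) * (6 * b + 5) - 1 =
        (6 * a * b + 5 * a + 5 * b + 4) * 6 by rw [Nat.sub_eq_iff_eq_add (by nlinarith)]; ring]
      exact Nat.mul_div_cancel _ (by norm_num)
    rw [this, hn₁, hn₂]
    push_cast
    ring
  have hMpos : 0 < M := by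
    have h₁ : (5 : ℤ) ≤ n₁ - 2 := by omega
    have h₂ : (5 : ℤ) ≤ n₂ - 2 := by omega
    have : (0 : ℤ) < M := by nlinarith
    exact_mod_cast this
  have hcount : ∀ w, IsUnit w → 4 * ((D₁ ∩ ((· + w) '' D₀)).ncard : ℤ) =
      6 * M + χ (-w) - χ w := fun w hw ↦ by
    have hcw := hw.map c
    rw [Prod.isUnit_iff] at hcw
    have h := four_mul_card_prodQuadraticChar hr₁ hr₂ hcw.1.ne_zero hcw.2.ne_zero
    have hset : D₁ ∩ ((· + w) '' D₀) = c.symm ''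
        (({x : ZMod n₁ × ZMod n₂ | prodQuadraticChar (ZMod n₁) (ZMod n₂) x = -1 ∧
          prodQuadraticChar (ZMod n₁) (ZMod n₂) (x - c w) = 1} : Finset _) : Set _) := by
      ext x
      rw [Set.image_add_right, Set.mem_inter_iff, hD₁χ, Set.mem_preimage, hD₀χ, ← sub_eq_add_neg]
      constructor
      · rintro ⟨h₁, h₂⟩
        refine ⟨c x, ?_, c.symm_apply_apply x⟩
        simpa [χ] using And.intro h₁ h₂
      · rintro ⟨y, hy, rfl⟩
        simpa [χ] using hy
    rw [hset, Set.ncard_image_of_injective _ c.symm.injective, Set.ncard_coe_finset, h,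
      ZMod.card, ZMod.card, hM']
    simp only [χ, map_neg]
  rw [hdiv]
  refine ⟨fun heven w hw ↦ ?_, fun hodd w hw ↦ ?_⟩
  · have hsum : Odd (a + b) := by
      have hnot : ¬ (Even a ∧ Even b) := fun ⟨h₁, h₂⟩ ↦ by
        have := Nat.dvd_gcd h₁.two_dvd h₂.two_dvd
        omega
      rw [Nat.even_mul] at heven
      rw [← Nat.not_even_iff_odd, Nat.even_add]
      tauto
    have h := hcount w hw
    rw [hχneg, hsum.neg_one_pow] at h
    constructor
    · intro hwD
      rw [(hD₀χ w).mp hwD] at h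
      omega
    · intro hwD
      rw [(hD₁χ w).mp hwD] at h
      omega
  · have hsum : Even (a + b) := by
      rw [Nat.odd_mul] at hodd
      exact hodd.1.add_odd hodd.2
    have h := hcount w hw
    rw [hχneg, hsum.neg_one_pow] at h
    omega
end

section
/- Let D₀ + w denote {t + w : t ∈ D₀} in ℤ/nℤ. If (n₁−1)(n₂−1)/36 is even, then for nonzero w ∈ ℤ/nℤ: |P ∩ (D₀ + w)| = 0 when w ∈ P; |P ∩ (D₀ + w)| = (n₂−1)/2 when w ∈ Q ∪ D₀; and |P ∩ (D₀ + w)| = (n₂−1)/2 − 1 when w ∈ D₁. If (n₁−1)(n₂−1)/36 is odd, then: |P ∩ (D₀ + w)| = 0 when w ∈ P; |P ∩ (D₀ + w)| = (n₂−1)/2 when w ∈ Q ∪ D₁; and |P ∩ (D₀ + w)| = (n₂−1)/2 − 1 when w ∈ D₀. -/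
section PrimitiveRoot

variable {p : ℕ} [Fact p.Prime] {g : ZMod p}

theorem ZMod.exists_eq_pow_of_orderOf_eq (hg : orderOf g = p - 1) {x : ZMod p} (hx : x ≠ 0) :
    ∃ a : ℕ, x = g ^ a := by
  have hp := (Fact.out : p.Prime).two_le
  have : NeZero (p - 1) := ⟨by omega⟩
  have hprim : IsPrimitiveRoot g (p - 1) := hg ▸ IsPrimitiveRoot.orderOf g
  obtain ⟨a, -, ha⟩ := hprim.eq_pow_of_pow_eq_one (ZMod.pow_card_sub_one_eq_one hx)
  exact ⟨a, ha.symm⟩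

theorem ZMod.ringChar_ne_two_of_odd (hp : Odd p) : ringChar (ZMod p) ≠ 2 := by
  rw [ZMod.ringChar_zmod_n]
  rintro rfl
  exact absurd hp (by decide)

theorem ZMod.quadraticChar_eq_neg_one_of_orderOf_eq (hp : Odd p) (hg : orderOf g = p - 1) :
    quadraticChar (ZMod p) g = -1 := by
  have hp2 := (Fact.out : p.Prime).two_le
  obtain ⟨k, hk⟩ := hp
  have hg0 : g ≠ 0 := by
    rintro rfl
    rw [orderOf_zero] at hg
    omega
  rw [quadraticChar_neg_one_iff_not_isSquare, ZMod.euler_criterion p hg0]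
  intro h
  have := Nat.le_of_dvd (by omega) (orderOf_dvd_of_pow_eq_one h)
  omega

theorem ZMod.quadraticChar_neg_one_eq_pow (hp : Odd p) :
    quadraticChar (ZMod p) (-1) = (-1) ^ ((p - 1) / 2) := by
  rw [quadraticChar_neg_one (ZMod.ringChar_ne_two_of_odd hp), ZMod.card,
    ZMod.χ₄_eq_neg_one_pow (Nat.odd_iff.mp hp)]
  congr 1
  obtain ⟨k, rfl⟩ := hp
  omega

theorem ZMod.two_mul_ncard_quadraticChar_eq (hp : Odd p) {c : ℤ} (hc : c = 1 ∨ c = -1) :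
    2 * {y : ZMod p | quadraticChar (ZMod p) y = c}.ncard = p - 1 := by
  have hpt (y : ZMod p) : (2 * if quadraticChar (ZMod p) y = c then 1 else 0 : ℤ) =
      (1 - if y = 0 then 1 else 0) + c * quadraticChar (ZMod p) y := by
    by_cases hy : y = 0
    · rcases hc with rfl | rfl <;> simp [hy]
    · rcases quadraticChar_dichotomy hy with h | h <;> rcases hc with rfl | rfl <;> simp [h, hy]
  have hsum := Finset.sum_congr rfl fun y (_ : y ∈ (Finset.univ : Finset (ZMod p))) => hpt y
  rw [← Finset.mul_sum, Finset.sum_add_distrib, ← Finset.mul_sum,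
    quadraticChar_sum_zero (ZMod.ringChar_ne_two_of_odd hp), Finset.sum_sub_distrib] at hsum
  simp only [Finset.sum_boole, Finset.sum_const, Finset.card_univ, ZMod.card,
    Finset.filter_eq', Finset.mem_univ, if_true, Finset.card_singleton, nsmul_eq_mul] at hsum
  rw [Set.ncard_eq_toFinset_card', Set.toFinset_ofPred]
  have := (Fact.out : p.Prime).two_le
  push_cast at hsum
  omega

theorem ZMod.ncard_ne_zero_quadraticChar_sub_eq (hp : Odd p) {c : ℤ} (hc : c = 1 ∨ c = -1)
    (w : ZMod p) :
    (quadraticChar (ZMod p) (-w) ≠ c →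
      2 * {y : ZMod p | y ≠ 0 ∧ quadraticChar (ZMod p) (y - w) = c}.ncard = p - 1) ∧
    (quadraticChar (ZMod p) (-w) = c →
      2 * ({y : ZMod p | y ≠ 0 ∧ quadraticChar (ZMod p) (y - w) = c}.ncard + 1) = p - 1) := by
  have hset : {y : ZMod p | y ≠ 0 ∧ quadraticChar (ZMod p) (y - w) = c} =
      (· + w) '' ({z | quadraticChar (ZMod p) z = c} \ {-w}) := by
    ext y
    simp only [Set.image_add_right, Set.mem_preimage, Set.mem_sdiff, Set.mem_ofPred_eq,
      Set.mem_singleton_iff, ← sub_eq_add_neg, sub_eq_neg_self]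
    tauto
  rw [hset, Set.ncard_image_of_injective _ (add_left_injective w),
    ← ZMod.two_mul_ncard_quadraticChar_eq hp hc]
  constructor <;> intro h
  · rw [Set.sdiff_singleton_eq_self]
    exact h
  · rw [Set.ncard_sdiff_singleton_add_one]
    exact h

end PrimitiveRoot

section Whiteman

variable {p q g u : ℕ} (E : ZMod (p * q) ≃+* ZMod p × ZMod q)

theorem ZMod.mem_multiples_iff_of_ringEquiv_prod [NeZero q] (hpq : p.Coprime q)
    (x : ZMod (p * q)) :
    (∃ k : ℕ, 1 ≤ k ∧ k ≤ q - 1 ∧ x = ((k * p : ℕ) : ZMod (p * q))) ↔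
      (E x).1 = 0 ∧ (E x).2 ≠ 0 := by
  have hunit : IsUnit (p : ZMod q) := (ZMod.isUnit_iff_coprime p q).mpr hpq
  constructor
  · rintro ⟨k, hk1, hk2, rfl⟩
    rw [map_natCast]
    refine ⟨by simp, ?_⟩
    rw [Prod.snd_natCast, Ne, ZMod.natCast_eq_zero_iff]
    intro h
    have := Nat.le_of_dvd hk1 (hpq.symm.dvd_of_dvd_mul_right h)
    omega
  · rintro ⟨h1, h2⟩
    obtain ⟨v, hv⟩ := hunit.exists_left_inv
    have hlt := ZMod.val_lt ((E x).2 * v)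
    refine ⟨((E x).2 * v).val, Nat.one_le_iff_ne_zero.mpr fun h => h2 ?_, by omega, ?_⟩
    · rw [ZMod.val_eq_zero] at h
      rw [← mul_one (E x).2, ← hv, ← mul_assoc, h, zero_mul]
    · apply E.injective
      rw [map_natCast]
      ext
      · simp [h1]
      · simp [mul_assoc, hv]

theorem ZMod.mem_whiteman_iff_of_ringEquiv_prod [Fact p.Prime] [Fact q.Prime]
    (hg₁ : orderOf (g : ZMod p) = p - 1) (hg₂ : orderOf (g : ZMod q) = q - 1)
    (hu₁ : (u : ZMod p) = (g : ZMod p)) (hu₂ : (u : ZMod q) = 1)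
    (i : ℕ) (x : ZMod (p * q)) :
    (∃ s < (p - 1) * (q - 1) / (p - 1).gcd (q - 1),
        x = (g : ZMod (p * q)) ^ s * (u : ZMod (p * q)) ^ i) ↔
      ∃ a b : ℕ, E x = ((g : ZMod p) ^ a, (g : ZMod q) ^ b) ∧
        a ≡ b + i [MOD (p - 1).gcd (q - 1)] := by
  have hp := (Fact.out : p.Prime).two_le
  have hq := (Fact.out : q.Prime).two_le
  have hE (s : ℕ) : E ((g : ZMod (p * q)) ^ s * (u : ZMod (p * q)) ^ i) =
      ((g : ZMod p) ^ (s + i), (g : ZMod q) ^ s) := by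
    rw [map_mul, map_pow, map_pow, map_natCast, map_natCast]
    ext <;> simp [hu₁, hu₂, pow_add]
  constructor
  · rintro ⟨s, -, rfl⟩
    exact ⟨s + i, s, hE s, rfl⟩
  · rintro ⟨a, b, hx, hab⟩
    -- `i * (p - 2)` represents `-i` modulo `p - 1`
    have hmul : i + i * (p - 2) = i * (p - 1) := by
      rw [show p - 1 = 1 + (p - 2) by omega, mul_add, mul_one]
    have hab' : a + i * (p - 2) ≡ b [MOD (p - 1).gcd (q - 1)] := by
      have h := hab.add_right (i * (p - 2))
      rw [add_assoc, hmul] at h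
      refine h.trans ?_
      simpa using Nat.ModEq.add_left b ((Nat.modEq_zero_iff_dvd.mpr
        ((Nat.gcd_dvd_left (p - 1) (q - 1)).mul_left i)))
    obtain ⟨s, hs1, hs2⟩ := Nat.chineseRemainder' hab'
    have hl : 0 < (p - 1).lcm (q - 1) := Nat.lcm_pos (by omega) (by omega)
    refine ⟨s % (p - 1).lcm (q - 1), Nat.mod_lt _ hl, E.injective ?_⟩
    have hmod := Nat.mod_modEq s ((p - 1).lcm (q - 1))
    have h1 := ((hmod.of_dvd (Nat.dvd_lcm_left _ _)).trans hs1).add_right i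
    have h2 := (hmod.of_dvd (Nat.dvd_lcm_right _ _)).trans hs2
    have h3 : a + i * (p - 2) + i ≡ a [MOD p - 1] := by
      rw [add_assoc, add_comm (i * _), hmul]
      simp
    rw [hE, hx, pow_eq_pow_of_modEq (h1.trans h3) (hg₁ ▸ pow_orderOf_eq_one _),
      pow_eq_pow_of_modEq h2 (hg₂ ▸ pow_orderOf_eq_one _)]

theorem ZMod.mem_whiteman_union_iff_of_ringEquiv_prod [Fact p.Prime] [Fact q.Prime]
    (hp : Odd p) (hq : Odd q) (h6 : (p - 1).gcd (q - 1) = 6)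
    (hg₁ : orderOf (g : ZMod p) = p - 1) (hg₂ : orderOf (g : ZMod q) = q - 1)
    (hu₁ : (u : ZMod p) = (g : ZMod p)) (hu₂ : (u : ZMod q) = 1)
    {W : ℕ → Set (ZMod (p * q))}
    (hW : ∀ i, W i = {x | ∃ s < (p - 1) * (q - 1) / 6,
      x = (g : ZMod (p * q)) ^ s * (u : ZMod (p * q)) ^ i})
    (j : ℕ) (x : ZMod (p * q)) :
    x ∈ W j ∪ W (j + 2) ∪ W (j + 4) ↔
      quadraticChar (ZMod p) (E x).1 * quadraticChar (ZMod q) (E x).2 = (-1) ^ j := by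
  have hmem (i : ℕ) : x ∈ W i ↔
      ∃ a b : ℕ, E x = ((g : ZMod p) ^ a, (g : ZMod q) ^ b) ∧ a ≡ b + i [MOD 6] := by
    have := ZMod.mem_whiteman_iff_of_ringEquiv_prod E hg₁ hg₂ hu₁ hu₂ i x
    rw [h6] at this
    rw [hW, ← this, Set.mem_ofPred_eq]
  have hχ (a b : ℕ) (h : E x = ((g : ZMod p) ^ a, (g : ZMod q) ^ b)) :
      quadraticChar (ZMod p) (E x).1 * quadraticChar (ZMod q) (E x).2 = (-1) ^ j ↔
        (Even (a + b) ↔ Even j) := by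
    rw [h, map_pow, map_pow, ZMod.quadraticChar_eq_neg_one_of_orderOf_eq hp hg₁,
      ZMod.quadraticChar_eq_neg_one_of_orderOf_eq hq hg₂, ← pow_add]
    rcases Nat.even_or_odd (a + b) with h₁ | h₁ <;> rcases Nat.even_or_odd j with h₂ | h₂ <;>
      simp [h₁.neg_one_pow, h₂.neg_one_pow, h₁, h₂, Nat.not_even_iff_odd.mpr]
  simp only [Set.mem_union, hmem]
  constructor
  · rintro ((⟨a, b, h, hab⟩ | ⟨a, b, h, hab⟩) | ⟨a, b, h, hab⟩) <;>
    · rw [hχ a b h]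
      simp only [Nat.ModEq, Nat.even_iff] at *
      omega
  · intro h
    have h₀ : quadraticChar (ZMod p) (E x).1 * quadraticChar (ZMod q) (E x).2 ≠ 0 := by
      rw [h]
      exact pow_ne_zero _ (by norm_num)
    rw [mul_ne_zero_iff, Ne, Ne, quadraticChar_eq_zero_iff, quadraticChar_eq_zero_iff] at h₀
    obtain ⟨a, ha⟩ := ZMod.exists_eq_pow_of_orderOf_eq hg₁ h₀.1
    obtain ⟨b, hb⟩ := ZMod.exists_eq_pow_of_orderOf_eq hg₂ h₀.2
    have hab : E x = ((g : ZMod p) ^ a, (g : ZMod q) ^ b) := Prod.ext ha hb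
    rw [hχ a b hab] at h
    have : a ≡ b + j [MOD 6] ∨ a ≡ b + (j + 2) [MOD 6] ∨ a ≡ b + (j + 4) [MOD 6] := by
      simp only [Nat.ModEq, Nat.even_iff] at *
      omega
    rcases this with h | h | h
    · exact .inl (.inl ⟨a, b, hab, h⟩)
    · exact .inl (.inr ⟨a, b, hab, h⟩)
    · exact .inr ⟨a, b, hab, h⟩

theorem ZMod.inter_translate_eq_of_ringEquiv_prod [Fact p.Prime] [Fact q.Prime]
    {P D : Set (ZMod (p * q))}
    (hP : ∀ x, x ∈ P ↔ (E x).1 = 0 ∧ (E x).2 ≠ 0)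
    (hD : ∀ x, x ∈ D ↔
      quadraticChar (ZMod p) (E x).1 * quadraticChar (ZMod q) (E x).2 = 1)
    (w : ZMod (p * q)) :
    P ∩ ((· + w) '' D) = (fun y => E.symm (0, y)) '' {y | y ≠ 0 ∧
      quadraticChar (ZMod p) (-(E w).1) * quadraticChar (ZMod q) (y - (E w).2) = 1} := by
  ext x
  rw [Set.image_add_right, Set.mem_inter_iff, Set.mem_preimage, hP, hD, ← sub_eq_add_neg,
    map_sub, Prod.fst_sub, Prod.snd_sub]
  constructor
  · rintro ⟨⟨h₁, h₂⟩, h⟩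
    refine ⟨(E x).2, ⟨h₂, by rwa [h₁, zero_sub] at h⟩, ?_⟩
    rw [RingEquiv.symm_apply_eq]
    exact Prod.ext h₁.symm rfl
  · rintro ⟨y, ⟨hy, h⟩, rfl⟩
    simpa [hy] using h

theorem ZMod.ncard_inter_translate_of_ringEquiv_prod [Fact p.Prime] [Fact q.Prime]
    (hq : Odd q) {P D : Set (ZMod (p * q))}
    (hP : ∀ x, x ∈ P ↔ (E x).1 = 0 ∧ (E x).2 ≠ 0)
    (hD : ∀ x, x ∈ D ↔
      quadraticChar (ZMod p) (E x).1 * quadraticChar (ZMod q) (E x).2 = 1)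
    {w : ZMod (p * q)} (hw : (E w).1 ≠ 0) :
    (quadraticChar (ZMod p) (-(E w).1) * quadraticChar (ZMod q) (-(E w).2) ≠ 1 →
      2 * (P ∩ ((· + w) '' D)).ncard = q - 1) ∧
    (quadraticChar (ZMod p) (-(E w).1) * quadraticChar (ZMod q) (-(E w).2) = 1 →
      2 * ((P ∩ ((· + w) '' D)).ncard + 1) = q - 1) := by
  have hc := quadraticChar_dichotomy (neg_ne_zero.mpr hw)
  have hmul (z : ℤ) : quadraticChar (ZMod p) (-(E w).1) * z = 1 ↔
      z = quadraticChar (ZMod p) (-(E w).1) := by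
    rcases hc with h | h <;> rw [h] <;> omega
  have hinj : Function.Injective fun y : ZMod q => E.symm (0, y) :=
    E.symm.injective.comp (Prod.mk_right_injective 0)
  rw [ZMod.inter_translate_eq_of_ringEquiv_prod E hP hD w, Set.ncard_image_of_injective _ hinj]
  simp only [Ne, hmul]
  exact ZMod.ncard_ne_zero_quadraticChar_sub_eq hq hc (E w).2

end Whiteman

theorem Nat.even_half_add_half_iff_of_gcd_eq_six {a b : ℕ} (h6 : a.gcd b = 6) :
    Even (a / 2 + b / 2) ↔ Odd (a * b / 36) := by
  obtain ⟨r, s, hrs, ha, hb⟩ := Nat.exists_coprime a b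
  rw [h6] at ha hb
  have hab : a * b / 36 = r * s := by
    rw [ha, hb, show r * 6 * (s * 6) = r * s * 36 by ring, Nat.mul_div_cancel _ (by norm_num)]
  have hnot : ¬ (Even r ∧ Even s) := fun h =>
    Nat.not_coprime_of_dvd_of_dvd one_lt_two h.1.two_dvd h.2.two_dvd hrs
  rw [hab, Nat.odd_mul, ha, hb, show r * 6 / 2 = 3 * r by omega, show s * 6 / 2 = 3 * s by omega]
  simp only [Nat.even_iff, Nat.odd_iff] at *
  omega


theorem stmt_4
    (n₁ n₂ n e g u : ℕ)
    (hp₁ : n₁.Prime) (hp₂ : n₂.Prime)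
    (hodd₁ : Odd n₁) (hodd₂ : Odd n₂) (hne : n₁ ≠ n₂)
    (h6 : Nat.gcd (n₁ - 1) (n₂ - 1) = 6)
    (hn : n = n₁ * n₂)
    (he : e = (n₁ - 1) * (n₂ - 1) / 6)
    (hg₁ : orderOf (g : ZMod n₁) = n₁ - 1)
    (hg₂ : orderOf (g : ZMod n₂) = n₂ - 1)
    (hu₁ : (u : ZMod n₁) = (g : ZMod n₁))
    (hu₂ : (u : ZMod n₂) = 1)
    (W : ℕ → Set (ZMod n))
    (hW : ∀ i, W i = {x | ∃ s < e, x = (g : ZMod n) ^ s * (u : ZMod n) ^ i})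
    (P Q : Set (ZMod n))
    (hP : P = {x | ∃ k : ℕ, 1 ≤ k ∧ k ≤ n₂ - 1 ∧ x = ((k * n₁ : ℕ) : ZMod n)})
    (hQ : Q = {x | ∃ k : ℕ, 1 ≤ k ∧ k ≤ n₁ - 1 ∧ x = ((k * n₂ : ℕ) : ZMod n)})
    (D₀ D₁ : Set (ZMod n))
    (hD₀ : D₀ = W 0 ∪ W 2 ∪ W 4) (hD₁ : D₁ = W 1 ∪ W 3 ∪ W 5) :
    (Even ((n₁ - 1) * (n₂ - 1) / 36) →
      ∀ w : ZMod n, w ≠ 0 →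
        (w ∈ P → (P ∩ ((· + w) '' D₀)).ncard = 0) ∧
        (w ∈ Q ∪ D₀ → 2 * (P ∩ ((· + w) '' D₀)).ncard = n₂ - 1) ∧
        (w ∈ D₁ → 2 * ((P ∩ ((· + w) '' D₀)).ncard + 1) = n₂ - 1)) ∧
    (Odd ((n₁ - 1) * (n₂ - 1) / 36) →
      ∀ w : ZMod n, w ≠ 0 →
        (w ∈ P → (P ∩ ((· + w) '' D₀)).ncard = 0) ∧
        (w ∈ Q ∪ D₁ → 2 * (P ∩ ((· + w) '' D₀)).ncard = n₂ - 1) ∧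
        (w ∈ D₀ → 2 * ((P ∩ ((· + w) '' D₀)).ncard + 1) = n₂ - 1)) := by
  subst hn he hD₀ hD₁ hQ
  have := Fact.mk hp₁
  have := Fact.mk hp₂
  have hco : n₁.Coprime n₂ := (Nat.coprime_primes hp₁ hp₂).mpr hne
  let E := ZMod.chineseRemainder hco
  have hmemP (x) : x ∈ P ↔ (E x).1 = 0 ∧ (E x).2 ≠ 0 := by
    rw [hP, ← ZMod.mem_multiples_iff_of_ringEquiv_prod E hco, Set.mem_ofPred_eq]
  have hmemD := ZMod.mem_whiteman_union_iff_of_ringEquiv_prod E hodd₁ hodd₂ h6 hg₁ hg₂ hu₁ hu₂ hW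
  have hmemD₀ (x) := hmemD 0 x
  have hmemD₁ (x) := hmemD 1 x
  simp only [zero_add, pow_zero, pow_one, Nat.reduceAdd] at hmemD₀ hmemD₁
  have hcard {w} := ZMod.ncard_inter_translate_of_ringEquiv_prod E hodd₂ hmemP hmemD₀ (w := w)
  have hsign (w : ZMod (n₁ * n₂)) :
      quadraticChar (ZMod n₁) (-(E w).1) * quadraticChar (ZMod n₂) (-(E w).2) =
        (-1) ^ ((n₁ - 1) / 2 + (n₂ - 1) / 2) *
          (quadraticChar (ZMod n₁) (E w).1 * quadraticChar (ZMod n₂) (E w).2) := by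
    rw [← neg_one_mul (E w).1, ← neg_one_mul (E w).2, map_mul, map_mul,
      ZMod.quadraticChar_neg_one_eq_pow hodd₁, ZMod.quadraticChar_neg_one_eq_pow hodd₂]
    ring
  have hne₁ {w : ZMod (n₁ * n₂)} {c : ℤ} (hc : c ≠ 0)
      (h : quadraticChar (ZMod n₁) (E w).1 * quadraticChar (ZMod n₂) (E w).2 = c) :
      (E w).1 ≠ 0 := by
    intro h₀
    rw [h₀, quadraticChar_zero, zero_mul] at h
    exact hc h.symm
  have hPcase (w : ZMod (n₁ * n₂)) (hw : (E w).1 = 0) :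
      (P ∩ ((· + w) '' (W 0 ∪ W 2 ∪ W 4))).ncard = 0 := by
    rw [ZMod.inter_translate_eq_of_ringEquiv_prod E hmemP hmemD₀ w]
    simp [hw]
  have hQmem (w : ZMod (n₁ * n₂)) (hw : ∃ k : ℕ, 1 ≤ k ∧ k ≤ n₁ - 1 ∧
      w = ((k * n₂ : ℕ) : ZMod (n₁ * n₂))) : (E w).1 ≠ 0 ∧ (E w).2 = 0 := by
    obtain ⟨k, hk₁, hk₂, rfl⟩ := hw
    rw [map_natCast, Prod.fst_natCast, Prod.snd_natCast, Ne, ZMod.natCast_eq_zero_iff]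
    refine ⟨fun h => ?_, by simp⟩
    have := Nat.le_of_dvd hk₁ (hco.dvd_of_dvd_mul_right h)
    omega
  have hpar := Nat.even_half_add_half_iff_of_gcd_eq_six h6
  constructor
  · intro hev w _
    have hodd : Odd ((n₁ - 1) / 2 + (n₂ - 1) / 2) := by
      rw [← Nat.not_even_iff_odd, hpar, Nat.not_odd_iff_even]
      exact hev
    refine ⟨fun hw => hPcase w ((hmemP w).mp hw).1, ?_, fun hw => ?_⟩
    · rintro (hw | hw)
      · obtain ⟨h₁, h₂⟩ := hQmem w hw
        exact (hcard h₁).1 (by simp [h₂])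
      · rw [hmemD₀] at hw
        exact (hcard (hne₁ one_ne_zero hw)).1 (by rw [hsign, hw, hodd.neg_one_pow]; norm_num)
    · rw [hmemD₁] at hw
      exact (hcard (hne₁ (by norm_num) hw)).2 (by rw [hsign, hw, hodd.neg_one_pow]; norm_num)
  · intro hod w _
    have heven : Even ((n₁ - 1) / 2 + (n₂ - 1) / 2) := hpar.mpr hod
    refine ⟨fun hw => hPcase w ((hmemP w).mp hw).1, ?_, fun hw => ?_⟩
    · rintro (hw | hw)
      · obtain ⟨h₁, h₂⟩ := hQmem w hw
        exact (hcard h₁).1 (by simp [h₂])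
      · rw [hmemD₁] at hw
        exact (hcard (hne₁ (by norm_num) hw)).1
          (by rw [hsign, hw, heven.neg_one_pow]; norm_num)
    · rw [hmemD₀] at hw
      exact (hcard (hne₁ one_ne_zero hw)).2 (by rw [hsign, hw, heven.neg_one_pow]; norm_num)
end

section
/- For every w ∈ ℤ/nℤ: |D₁ ∩ (({0} ∪ Q) + w)| = 0 if w ∈ {0} ∪ Q, and |D₁ ∩ (({0} ∪ Q) + w)| = (n₁−1)/2 otherwise, where ({0} ∪ Q) + w = {t + w : t ∈ {0} ∪ Q}. -/
/-- A power of a primitive root modulo a prime determines its exponent modulo `p - 1`. -/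
theorem ZMod.pow_eq_pow_iff_of_orderOf {p : ℕ} (hp : 1 < p) {g : ZMod p}
    (hg : orderOf g = p - 1) (a b : ℕ) : g ^ a = g ^ b ↔ a ≡ b [MOD p - 1] := by
  rw [← hg, ← pow_mod_orderOf g a, ← pow_mod_orderOf g b]
  have hpos : 0 < orderOf g := by omega
  refine ⟨fun h => ?_, fun h => by rw [h]⟩
  exact (IsPrimitiveRoot.orderOf g).pow_inj (Nat.mod_lt _ hpos) (Nat.mod_lt _ hpos) h

/-- Every nonzero residue modulo a prime is a power of a primitive root. -/
theorem ZMod.exists_pow_eq_of_orderOf {p : ℕ} [Fact p.Prime] {g : ZMod p}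
    (hg : orderOf g = p - 1) {y : ZMod p} (hy : y ≠ 0) : ∃ b : ℕ, y = g ^ b := by
  have hp := (Fact.out : p.Prime).two_le
  have : NeZero (p - 1) := ⟨by omega⟩
  have hprim : IsPrimitiveRoot g (p - 1) := hg ▸ IsPrimitiveRoot.orderOf g
  obtain ⟨i, -, hi⟩ := hprim.eq_pow_of_pow_eq_one (ZMod.pow_card_sub_one_eq_one hy)
  exact ⟨i, hi.symm⟩

/-- Simultaneous congruences for moduli with gcd `6`, up to an odd shift of one of them. -/
theorem Nat.exists_lt_odd_shift_modEq {m₁ m₂ : ℕ} (h6 : Nat.gcd m₁ m₂ = 6) (hm₁ : 0 < m₁)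
    (hm₂ : 0 < m₂) {a b : ℕ} (hab : (a + b) % 2 = 1) :
    ∃ s < m₁ * m₂ / 6, ∃ i, (i = 1 ∨ i = 3 ∨ i = 5) ∧
      s + i ≡ a [MOD m₁] ∧ s ≡ b [MOD m₂] := by
  obtain ⟨i, hi⟩ : ∃ i, i = (a + 5 * b) % 6 := ⟨_, rfl⟩
  obtain ⟨k, hk⟩ : 6 ∣ m₁ := h6 ▸ Nat.gcd_dvd_left m₁ m₂
  have hcong : a + m₁ * 6 - i ≡ b [MOD Nat.gcd m₁ m₂] := by
    rw [h6, Nat.ModEq]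
    omega
  have hlt := Nat.chineseRemainder'_lt_lcm hcong hm₁.ne' hm₂.ne'
  refine ⟨(Nat.chineseRemainder' hcong : ℕ), ?_, i, by omega, ?_,
    (Nat.chineseRemainder' hcong).2.2⟩
  · rwa [Nat.lcm, h6] at hlt
  · have h := (Nat.chineseRemainder' hcong).2.1.add_right i
    rw [Nat.sub_add_cancel (by omega)] at h
    exact h.trans (by simp [Nat.ModEq])

/-- The residues modulo `m * n` vanishing modulo `n` are zero and the multiples `k * n` with
`1 ≤ k < m`. -/
theorem ZMod.chineseRemainder_snd_eq_zero_iff {m n : ℕ} (h : m.Coprime n) (hm : 0 < m)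
    (hn : 0 < n) (x : ZMod (m * n)) :
    (ZMod.chineseRemainder h x).2 = 0 ↔
      x ∈ ({0} ∪ {x | ∃ k : ℕ, 1 ≤ k ∧ k ≤ m - 1 ∧ x = ((k * n : ℕ) : ZMod (m * n))} :
        Set (ZMod (m * n))) := by
  have : NeZero (m * n) := ⟨(Nat.mul_pos hm hn).ne'⟩
  constructor
  · intro hx
    have hx' : ((x.val : ℕ) : ZMod n) = 0 := by
      rw [← ZMod.natCast_zmod_val x, map_natCast] at hx
      simpa using hx
    obtain ⟨k, hk⟩ := (ZMod.natCast_eq_zero_iff _ _).1 hx'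
    have hxk : x = ((k * n : ℕ) : ZMod (m * n)) := by
      rw [mul_comm k, ← hk, ZMod.natCast_zmod_val]
    have hlt : k < m := by
      have := ZMod.val_lt x
      rw [hk, mul_comm m] at this
      exact Nat.lt_of_mul_lt_mul_left this
    rcases Nat.eq_zero_or_pos k with rfl | hpos
    · left; simpa using hxk
    · exact Or.inr ⟨k, hpos, by omega, hxk⟩
  · rintro (rfl | ⟨k, -, -, rfl⟩)
    · simp
    · rw [map_natCast]
      simp


theorem stmt_5
    (n₁ n₂ n e g u : ℕ)
    (hp₁ : n₁.Prime) (hp₂ : n₂.Prime)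
    (hodd₁ : Odd n₁) (hodd₂ : Odd n₂) (hne : n₁ ≠ n₂)
    (h6 : Nat.gcd (n₁ - 1) (n₂ - 1) = 6)
    (hn : n = n₁ * n₂)
    (he : e = (n₁ - 1) * (n₂ - 1) / 6)
    (hg₁ : orderOf (g : ZMod n₁) = n₁ - 1)
    (hg₂ : orderOf (g : ZMod n₂) = n₂ - 1)
    (hu₁ : (u : ZMod n₁) = (g : ZMod n₁))
    (hu₂ : (u : ZMod n₂) = 1)
    (W : ℕ → Set (ZMod n))
    (hW : ∀ i, W i = {x | ∃ s < e, x = (g : ZMod n) ^ s * (u : ZMod n) ^ i})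
    (P Q : Set (ZMod n))
    (hP : P = {x | ∃ k : ℕ, 1 ≤ k ∧ k ≤ n₂ - 1 ∧ x = ((k * n₁ : ℕ) : ZMod n)})
    (hQ : Q = {x | ∃ k : ℕ, 1 ≤ k ∧ k ≤ n₁ - 1 ∧ x = ((k * n₂ : ℕ) : ZMod n)})
    (D₀ D₁ : Set (ZMod n))
    (hD₀ : D₀ = W 0 ∪ W 2 ∪ W 4) (hD₁ : D₁ = W 1 ∪ W 3 ∪ W 5) :
    ∀ w : ZMod n,
      (w ∈ ({0} ∪ Q : Set (ZMod n)) →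
        (D₁ ∩ ((· + w) '' ({0} ∪ Q))).ncard = 0) ∧
      (w ∉ ({0} ∪ Q : Set (ZMod n)) →
        2 * (D₁ ∩ ((· + w) '' ({0} ∪ Q))).ncard = n₁ - 1) := by
  subst hn
  have hF₁ : Fact n₁.Prime := ⟨hp₁⟩
  have hF₂ : Fact n₂.Prime := ⟨hp₂⟩
  have hcop : n₁.Coprime n₂ := (Nat.coprime_primes hp₁ hp₂).2 hne
  have h2₁ := hp₁.two_le
  have h2₂ := hp₂.two_le
  have hdvd₁ : 6 ∣ n₁ - 1 := h6 ▸ Nat.gcd_dvd_left _ _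
  have hdvd₂ : 6 ∣ n₂ - 1 := h6 ▸ Nat.gcd_dvd_right _ _
  have heven₁ : 2 ∣ n₁ - 1 := Dvd.dvd.trans (by norm_num) hdvd₁
  have heven₂ : 2 ∣ n₂ - 1 := Dvd.dvd.trans (by norm_num) hdvd₂
  let φ := ZMod.chineseRemainder hcop
  have hpow : ∀ s i : ℕ, φ ((g : ZMod (n₁ * n₂)) ^ s * (u : ZMod (n₁ * n₂)) ^ i) =
      ((g : ZMod n₁) ^ (s + i), (g : ZMod n₂) ^ s) := by
    intro s i
    rw [map_mul, map_pow, map_pow, map_natCast, map_natCast]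
    ext <;> simp [hu₁, hu₂, pow_add]
  have hQ' : ∀ x, x ∈ ({0} ∪ Q : Set (ZMod (n₁ * n₂))) ↔ (φ x).2 = 0 := by
    intro x
    rw [hQ]
    exact (ZMod.chineseRemainder_snd_eq_zero_iff hcop hp₁.pos hp₂.pos x).symm
  have hD : ∀ x, x ∈ D₁ ↔ ∃ a b : ℕ, (a + b) % 2 = 1 ∧
      φ x = ((g : ZMod n₁) ^ a, (g : ZMod n₂) ^ b) := by
    intro x
    simp only [hD₁, hW, Set.mem_union, Set.mem_ofPred_eq]
    constructor
    · rintro ((⟨s, -, rfl⟩ | ⟨s, -, rfl⟩) | ⟨s, -, rfl⟩) <;>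
        exact ⟨_, s, by omega, hpow s _⟩
    · rintro ⟨a, b, hab, hx⟩
      obtain ⟨s, hs, i, hi, h₁, h₂⟩ :=
        Nat.exists_lt_odd_shift_modEq h6 (by omega) (by omega) hab
      have hxs : x = (g : ZMod (n₁ * n₂)) ^ s * (u : ZMod (n₁ * n₂)) ^ i := by
        apply φ.injective
        rw [hpow, hx, (ZMod.pow_eq_pow_iff_of_orderOf hp₁.one_lt hg₁ _ _).2 h₁,
          (ZMod.pow_eq_pow_iff_of_orderOf hp₂.one_lt hg₂ _ _).2 h₂]
      rw [← he] at hs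
      rcases hi with rfl | rfl | rfl
      · exact Or.inl (Or.inl ⟨s, hs, hxs⟩)
      · exact Or.inl (Or.inr ⟨s, hs, hxs⟩)
      · exact Or.inr ⟨s, hs, hxs⟩
  intro w
  have htrans : ∀ x, x ∈ (· + w) '' ({0} ∪ Q) ↔ (φ x).2 = (φ w).2 := by
    intro x
    constructor
    · rintro ⟨t, ht, rfl⟩
      simp [(hQ' t).1 ht]
    · intro hx
      exact ⟨x - w, (hQ' _).2 (by simp [hx]), by simp⟩
  rw [hQ' w]
  constructor
  · intro hw
    convert Set.ncard_empty (ZMod (n₁ * n₂))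
    refine Set.eq_empty_of_forall_notMem ?_
    rintro x ⟨hx, hxw⟩
    obtain ⟨a, b, -, hab⟩ := (hD x).1 hx
    rw [htrans, hw, hab] at hxw
    have hg0 : (g : ZMod n₂) = 0 := eq_zero_of_pow_eq_zero hxw
    rw [hg0, orderOf_zero] at hg₂
    omega
  · intro hw
    obtain ⟨b, hb⟩ := ZMod.exists_pow_eq_of_orderOf hg₂ hw
    obtain ⟨m, hm⟩ := heven₁
    have hm0 : 0 < m := by omega
    let f : ℕ → ZMod (n₁ * n₂) := fun t => φ.symm ((g : ZMod n₁) ^ (b + 1 + 2 * t), (φ w).2)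
    have himage : D₁ ∩ ((· + w) '' ({0} ∪ Q)) = f '' (Finset.range m : Set ℕ) := by
      ext x
      rw [Set.mem_inter_iff, hD, htrans]
      constructor
      · rintro ⟨⟨a, c, hac, hx⟩, hxw⟩
        have hcb : c % 2 = b % 2 := by
          rw [hb, hx] at hxw
          exact ((ZMod.pow_eq_pow_iff_of_orderOf hp₂.one_lt hg₂ _ _).1 hxw).of_dvd heven₂
        have hle : b + 1 ≤ 2 * m * (b + 1) := Nat.le_mul_of_pos_left _ (by omega)
        obtain ⟨r, hr⟩ : ∃ r, a + 2 * m * (b + 1) = b + 1 + 2 * r := by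
          have hev : (2 * m * (b + 1)) % 2 = 0 := by simp [mul_assoc]
          exact ⟨(a + 2 * m * (b + 1) - (b + 1)) / 2, by omega⟩
        refine ⟨r % m, by simpa using Nat.mod_lt r hm0, ?_⟩
        apply φ.injective
        simp only [f, RingEquiv.apply_symm_apply]
        refine Prod.ext ?_ hxw.symm
        rw [hx]
        refine (ZMod.pow_eq_pow_iff_of_orderOf hp₁.one_lt hg₁ _ _).2 ?_
        rw [hm]
        have h₁ : b + 1 + 2 * (r % m) ≡ b + 1 + 2 * r [MOD 2 * m] :=
          ((Nat.mod_modEq r m).mul_left' 2).add_left _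
        refine h₁.trans ?_
        rw [← hr]
        exact Nat.add_mul_mod_self_left a (2 * m) (b + 1)
      · rintro ⟨t, -, rfl⟩
        simp only [f, RingEquiv.apply_symm_apply, and_true]
        exact ⟨b + 1 + 2 * t, b, by omega, by rw [hb]⟩
    have hinj : Set.InjOn f (Finset.range m : Set ℕ) := by
      intro t ht t' ht' h
      have h₁ := congrArg Prod.fst (φ.symm.injective h)
      have h₂ := (ZMod.pow_eq_pow_iff_of_orderOf hp₁.one_lt hg₁ _ _).1 h₁
      rw [hm] at h₂
      have h₃ := Nat.ModEq.mul_left_cancel' two_ne_zero (Nat.ModEq.add_left_cancel' _ h₂)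
      exact h₃.eq_of_lt_of_lt (by simpa using ht) (by simpa using ht')
    rw [himage, hinj.ncard_image, Set.ncard_coe_finset, Finset.card_range, hm]
end

section
/- For every w ∈ ℤ/nℤ: |P ∩ (({0} ∪ Q) + w)| = 1 if w ∈ P; |P ∩ (({0} ∪ Q) + w)| = 0 if w ∈ Q; and |P ∩ (({0} ∪ Q) + w)| = 1 if w is a unit of ℤ/nℤ; where ({0} ∪ Q) + w = {t + w : t ∈ {0} ∪ Q}. -/
/-- The residues `k * a` modulo `a * b` with `1 ≤ k ≤ b - 1` are the nonzero ones that vanish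
modulo `a`. -/
theorem ZMod.exists_eq_natCast_mul_iff {a b n : ℕ} [NeZero n] (hn : n = a * b) (x : ZMod n) :
    (∃ k : ℕ, 1 ≤ k ∧ k ≤ b - 1 ∧ x = ((k * a : ℕ) : ZMod n)) ↔
      ZMod.castHom (Dvd.intro b hn.symm) (ZMod a) x = 0 ∧ x ≠ 0 := by
  have ha : 0 < a := Nat.pos_of_ne_zero fun h => NeZero.ne n (by simp [hn, h])
  constructor
  · rintro ⟨k, hk, hkb, rfl⟩
    refine ⟨by rw [map_natCast]; simp, fun h => ?_⟩
    rw [ZMod.natCast_eq_zero_iff, hn, mul_comm a b] at h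
    have := Nat.le_of_dvd hk (Nat.dvd_of_mul_dvd_mul_right ha h)
    omega
  · rintro ⟨h, hx⟩
    rw [← ZMod.natCast_zmod_val x, map_natCast, ZMod.natCast_eq_zero_iff] at h
    obtain ⟨k, hk⟩ := h
    have hk0 : k ≠ 0 := by
      rintro rfl
      exact hx ((ZMod.val_eq_zero x).1 (by simpa using hk))
    have hkb : k < b := by
      have := ZMod.val_lt x
      rw [hk, hn] at this
      exact Nat.lt_of_mul_lt_mul_left this
    exact ⟨k, by omega, by omega, by rw [mul_comm, ← hk, ZMod.natCast_zmod_val]⟩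

/-- For coprime `a` and `b`, a residue modulo `a * b` is determined by its reductions modulo `a`
and `b`, and these can be prescribed. -/
theorem ZMod.castHom_prod_bijective {a b n : ℕ} (hn : n = a * b) (hab : a.Coprime b) :
    Function.Bijective fun x : ZMod n =>
      (ZMod.castHom (Dvd.intro b hn.symm) (ZMod a) x,
        ZMod.castHom (Dvd.intro_left a hn.symm) (ZMod b) x) := by
  subst hn
  have h : (ZMod.chineseRemainder hab : ZMod (a * b) →+* ZMod a × ZMod b) =
      (ZMod.castHom (Dvd.intro b rfl) (ZMod a)).prod
        (ZMod.castHom (Dvd.intro_left a rfl) (ZMod b)) := RingHom.ext_zmod _ _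
  convert (ZMod.chineseRemainder hab).bijective using 1
  exact (congrArg (fun f : ZMod (a * b) →+* ZMod a × ZMod b => (f : _ → _)) h).symm


theorem stmt_6
    (n₁ n₂ n e g u : ℕ)
    (hp₁ : n₁.Prime) (hp₂ : n₂.Prime)
    (hodd₁ : Odd n₁) (hodd₂ : Odd n₂) (hne : n₁ ≠ n₂)
    (h6 : Nat.gcd (n₁ - 1) (n₂ - 1) = 6)
    (hn : n = n₁ * n₂)
    (he : e = (n₁ - 1) * (n₂ - 1) / 6)
    (hg₁ : orderOf (g : ZMod n₁) = n₁ - 1)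
    (hg₂ : orderOf (g : ZMod n₂) = n₂ - 1)
    (hu₁ : (u : ZMod n₁) = (g : ZMod n₁))
    (hu₂ : (u : ZMod n₂) = 1)
    (W : ℕ → Set (ZMod n))
    (hW : ∀ i, W i = {x | ∃ s < e, x = (g : ZMod n) ^ s * (u : ZMod n) ^ i})
    (P Q : Set (ZMod n))
    (hP : P = {x | ∃ k : ℕ, 1 ≤ k ∧ k ≤ n₂ - 1 ∧ x = ((k * n₁ : ℕ) : ZMod n)})
    (hQ : Q = {x | ∃ k : ℕ, 1 ≤ k ∧ k ≤ n₁ - 1 ∧ x = ((k * n₂ : ℕ) : ZMod n)}) :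
    ∀ w : ZMod n,
      (w ∈ P → (P ∩ ((· + w) '' ({0} ∪ Q))).ncard = 1) ∧
      (w ∈ Q → (P ∩ ((· + w) '' ({0} ∪ Q))).ncard = 0) ∧
      (IsUnit w → (P ∩ ((· + w) '' ({0} ∪ Q))).ncard = 1) := by
  have : Fact n₂.Prime := ⟨hp₂⟩
  have : NeZero n := ⟨by rw [hn]; exact mul_ne_zero hp₁.ne_zero hp₂.ne_zero⟩
  have hbij := ZMod.castHom_prod_bijective hn ((Nat.coprime_primes hp₁ hp₂).2 hne)
  set φ₁ := ZMod.castHom (Dvd.intro n₂ hn.symm) (ZMod n₁)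
  set φ₂ := ZMod.castHom (Dvd.intro_left n₁ hn.symm) (ZMod n₂)
  have hP' : ∀ x, x ∈ P ↔ φ₁ x = 0 ∧ x ≠ 0 := fun x => by
    rw [hP]; exact ZMod.exists_eq_natCast_mul_iff hn x
  have hQ' : ∀ x, x ∈ Q ↔ φ₂ x = 0 ∧ x ≠ 0 := fun x => by
    rw [hQ]; exact ZMod.exists_eq_natCast_mul_iff (hn.trans (mul_comm _ _)) x
  have hzero : ∀ x, φ₁ x = 0 → φ₂ x = 0 → x = 0 := fun x h₁ h₂ =>
    hbij.1 (by simp [h₁, h₂])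
  have hmem : ∀ w x, x ∈ P ∩ ((· + w) '' ({0} ∪ Q)) ↔ φ₁ x = 0 ∧ φ₂ x = φ₂ w ∧ φ₂ w ≠ 0 := by
    intro w x
    have hshift : x ∈ (· + w) '' ({0} ∪ Q) ↔ φ₂ x = φ₂ w := by
      rw [Set.image_add_right, Set.mem_preimage, ← sub_eq_add_neg, Set.mem_union,
        Set.mem_singleton_iff, hQ', ← sub_eq_zero (a := φ₂ x), ← map_sub]
      by_cases h : x - w = 0 <;> simp only [h, map_zero] <;> tauto
    rw [Set.mem_inter_iff, hP', hshift]
    constructor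
    · rintro ⟨⟨h₁, hx⟩, h₂⟩
      exact ⟨h₁, h₂, fun h => hx (hzero x h₁ (h₂.trans h))⟩
    · rintro ⟨h₁, h₂, hw⟩
      exact ⟨⟨h₁, fun h => hw (by rw [← h₂, h, map_zero])⟩, h₂⟩
  have hone : ∀ w, φ₂ w ≠ 0 → (P ∩ ((· + w) '' ({0} ∪ Q))).ncard = 1 := by
    intro w hw
    obtain ⟨y, hy⟩ := hbij.2 (0, φ₂ w)
    obtain ⟨hy₁, hy₂⟩ := Prod.mk.inj hy
    refine Set.ncard_eq_one.2 ⟨y, Set.ext fun x => ?_⟩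
    rw [hmem, Set.mem_singleton_iff]
    constructor
    · rintro ⟨h₁, h₂, -⟩
      exact hbij.1 (Prod.ext (h₁.trans hy₁.symm) (h₂.trans hy₂.symm))
    · rintro rfl
      exact ⟨hy₁, hy₂, hw⟩
  refine fun w => ⟨fun hw => hone w fun h => ?_, fun hw => ?_, fun hw => hone w (hw.map φ₂).ne_zero⟩
  · exact ((hP' w).1 hw).2 (hzero w ((hP' w).1 hw).1 h)
  · rw [Set.ncard_eq_zero, Set.eq_empty_iff_forall_notMem]
    exact fun x hx => ((hmem w x).1 hx).2.2 ((hQ' w).1 hw).1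
end

section
/- Suppose (n₁−1)(n₂−1)/36 is odd. Then for 0 < w ≤ n−1 the autocorrelation of the sequence λ satisfies: C_λ(w) = (n₂−n₁−3)/n if w mod n ∈ P; C_λ(w) = (n₁+1−n₂)/n if w mod n ∈ Q; C_λ(w) = 1/n if w mod n ∈ W₀ ∪ W₂ ∪ W₄; and C_λ(w) = −3/n if w mod n ∈ W₁ ∪ W₃ ∪ W₅. -/
open Finset

section Correlation

variable {F : Type*} [Field F] [Fintype F] [DecidableEq F]

theorem sum_quadraticChar_mul_shift (hF : ringChar F ≠ 2) {w : F} (hw : w ≠ 0) :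
    ∑ x : F, quadraticChar F x * quadraticChar F (x + w) = -1 := by
  have hJ := jacobiSum_nontrivial_inv (quadraticChar_ne_one hF)
  rw [(quadraticChar_isQuadratic F).inv] at hJ
  have hneg : quadraticChar F (-1) * quadraticChar F (-1) = 1 := by
    rw [← map_mul]; simp
  have hsq : quadraticChar F w * quadraticChar F w = 1 := by
    rw [← sq, quadraticChar_sq_one hw]
  have key : ∑ x : F, quadraticChar F x * quadraticChar F (x + w)
      = quadraticChar F (-1) * jacobiSum (quadraticChar F) (quadraticChar F) := by
    rw [jacobiSum, mul_sum,
      ← Equiv.sum_comp (Equiv.mulLeft₀ (-w) (neg_ne_zero.mpr hw))]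
    refine sum_congr rfl fun x _ => ?_
    have h₁ : (Equiv.mulLeft₀ (-w) (neg_ne_zero.mpr hw)) x = (-1) * w * x := by simp
    have h₂ : (-1) * w * x + w = w * (1 - x) := by ring
    rw [h₁, h₂]
    simp only [map_mul]
    linear_combination
      (quadraticChar F (-1) * quadraticChar F x * quadraticChar F (1 - x)) * hsq
  rw [key, hJ]
  linear_combination -hneg

theorem sum_quadraticChar_mul_self :
    ∑ x : F, quadraticChar F x * quadraticChar F x = Fintype.card F - 1 := by
  have h : ∀ x : F, quadraticChar F x * quadraticChar F x = 1 - if x = 0 then 1 else 0 := by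
    intro x
    by_cases hx : x = 0
    · simp [hx]
    · rw [← sq, quadraticChar_sq_one hx]; simp [hx]
  rw [sum_congr rfl fun x _ => h x]
  simp

theorem sum_prod_expand {α β : Type*} [Fintype α] [Fintype β] (a a' d d' : α → ℤ)
    (b b' c c' : β → ℤ) :
    ∑ x : α × β, (a' x.1 * b' x.2 + c' x.2 - d' x.1 + d' x.1 * c' x.2) *
        (a x.1 * b x.2 + c x.2 - d x.1 + d x.1 * c x.2) =
      (∑ x, a x * a' x) * (∑ x, b x * b' x) + (∑ x, a' x) * (∑ x, b' x * c x)
      - (∑ x, a' x * d x) * (∑ x, b' x) + (∑ x, a' x * d x) * (∑ x, b' x * c x)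
      + (∑ x, a x) * (∑ x, b x * c' x) + (∑ _x : α, 1) * (∑ x, c x * c' x)
      - (∑ x, d x) * (∑ x, c' x) + (∑ x, d x) * (∑ x, c x * c' x)
      - (∑ x, a x * d' x) * (∑ x, b x) - (∑ x, d' x) * (∑ x, c x)
      + (∑ x, d x * d' x) * (∑ _x : β, 1) - (∑ x, d x * d' x) * (∑ x, c x)
      + (∑ x, a x * d' x) * (∑ x, b x * c' x) + (∑ x, d' x) * (∑ x, c x * c' x)
      - (∑ x, d x * d' x) * (∑ x, c' x) + (∑ x, d x * d' x) * (∑ x, c x * c' x) := by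
  simp only [Fintype.sum_prod_type, sum_mul_sum, ← sum_add_distrib, ← sum_sub_distrib]
  exact sum_congr rfl fun x _ => sum_congr rfl fun y _ => by ring

variable {K : Type*} [Field K] [Fintype K] [DecidableEq K]

/-- The `±1`-valued sequence on `F × K` that is the product of the quadratic characters at units,
`-1` at the nonzero points of `{0} × K`, and `1` at the remaining points. -/
def twoPrimeSign (x : F × K) : ℤ :=
  quadraticChar F x.1 * quadraticChar K x.2 + (if x.2 = 0 then 1 else 0)
    - (if x.1 = 0 then 1 else 0) + (if x.1 = 0 then 1 else 0) * (if x.2 = 0 then 1 else 0)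

theorem sum_twoPrimeSign_mul_shift (hF : ringChar F ≠ 2) (hK : ringChar K ≠ 2) (w : F × K) :
    ∑ x : F × K, twoPrimeSign (x + w) * twoPrimeSign x =
      (∑ x : F, quadraticChar F x * quadraticChar F (x + w.1)) *
        (∑ x : K, quadraticChar K x * quadraticChar K (x + w.2))
      + quadraticChar F w.1 * quadraticChar K w.2
      + quadraticChar F (-w.1) * quadraticChar K (-w.2)
      + (if w.2 = 0 then (Fintype.card F : ℤ) + 2 else 0)
      + (if w.1 = 0 then (Fintype.card K : ℤ) - 2 else 0) - 2
      + (if w.1 = 0 then 1 else 0) * (if w.2 = 0 then 1 else 0) := by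
  have hF0 := quadraticChar_sum_zero hF
  have hK0 := quadraticChar_sum_zero hK
  have hF0' : ∑ x : F, quadraticChar F (x + w.1) = 0 := by
    rw [← hF0]; exact Equiv.sum_comp (Equiv.addRight w.1) (fun x => quadraticChar F x)
  have hK0' : ∑ x : K, quadraticChar K (x + w.2) = 0 := by
    rw [← hK0]; exact Equiv.sum_comp (Equiv.addRight w.2) (fun x => quadraticChar K x)
  unfold twoPrimeSign
  refine (sum_prod_expand (fun x : F => quadraticChar F x) (fun x => quadraticChar F (x + w.1))
    (fun x => if x = 0 then 1 else 0) (fun x => if x + w.1 = 0 then 1 else 0)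
    (fun x : K => quadraticChar K x) (fun x => quadraticChar K (x + w.2))
    (fun x => if x = 0 then 1 else 0) (fun x => if x + w.2 = 0 then 1 else 0)).trans ?_
  simp only [hF0, hK0, hF0', hK0']
  simp only [add_eq_zero_iff_eq_neg, mul_ite, mul_one, mul_zero, sum_ite_eq', mem_univ, if_true,
    zero_add, sum_const, card_univ, nsmul_eq_mul, neg_eq_zero]
  split_ifs <;> ring

end Correlation

section TwoPrime

variable {F : Type*} [Field F] [Fintype F] [DecidableEq F]
variable {K : Type*} [Field K] [Fintype K] [DecidableEq K]

theorem quadraticChar_eq_neg_one_of_orderOf (hF : ringChar F ≠ 2) {γ : F}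
    (hγ : orderOf γ = Fintype.card F - 1) : quadraticChar F γ = -1 := by
  have hodd := FiniteField.odd_card_of_char_ne_two hF
  have hcard := Fintype.one_lt_card (α := F)
  have h0 : γ ≠ 0 := by
    rintro rfl
    rw [orderOf_zero] at hγ
    omega
  rw [quadraticChar_eq_neg_one_iff_not_one h0, quadraticChar_one_iff_isSquare h0,
    FiniteField.isSquare_iff hF h0]
  intro h
  have := Nat.le_of_dvd (by omega) (orderOf_dvd_of_pow_eq_one h)
  omega

theorem exists_pow_eq_of_orderOf {F : Type*} [Field F] [Fintype F] {γ : F}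
    (hγ : orderOf γ = Fintype.card F - 1) {x : F} (hx : x ≠ 0) : ∃ a : ℕ, x = γ ^ a := by
  have hcard := Fintype.one_lt_card (α := F)
  have h := IsPrimitiveRoot.orderOf γ
  rw [hγ] at h
  have : NeZero (Fintype.card F - 1) := ⟨by omega⟩
  obtain ⟨a, -, ha⟩ := h.eq_pow_of_pow_eq_one (FiniteField.pow_card_sub_one_eq_one x hx)
  exact ⟨a, ha.symm⟩

/-- A point of `F × K` with nonzero coordinates and quadratic character product `-1` lies in an
odd cyclotomic class of order `6`. -/
theorem exists_pow_mul_pow_of_char_mul_eq_neg_one (hF : ringChar F ≠ 2) (hK : ringChar K ≠ 2)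
    (h6 : Nat.gcd (Fintype.card F - 1) (Fintype.card K - 1) = 6) {γ : F} {δ : K}
    (hγ : orderOf γ = Fintype.card F - 1) (hδ : orderOf δ = Fintype.card K - 1) {x : F} {y : K}
    (hxy : quadraticChar F x * quadraticChar K y = -1) :
    ∃ i < 6, Odd i ∧ ∃ s < (Fintype.card F - 1) * (Fintype.card K - 1) / 6,
      x = γ ^ s * γ ^ i ∧ y = δ ^ s := by
  have hx : x ≠ 0 := by rintro rfl; simp at hxy
  have hy : y ≠ 0 := by rintro rfl; simp at hxy
  obtain ⟨a, rfl⟩ := exists_pow_eq_of_orderOf hγ hx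
  obtain ⟨b, rfl⟩ := exists_pow_eq_of_orderOf hδ hy
  rw [map_pow, map_pow, quadraticChar_eq_neg_one_of_orderOf hF hγ,
    quadraticChar_eq_neg_one_of_orderOf hK hδ, ← pow_add] at hxy
  have hab : Odd (a + b) := (neg_one_pow_eq_neg_one_iff_odd (by norm_num)).mp hxy
  have hcF := Fintype.one_lt_card (α := F)
  have hcK := Fintype.one_lt_card (α := K)
  generalize hM : Fintype.card F - 1 = M at *
  generalize hN : Fintype.card K - 1 = N at *
  have hM6 : 6 ∣ M := h6 ▸ Nat.gcd_dvd_left M N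
  have hMpos : 0 < M := by omega
  have hNpos : 0 < N := by omega
  have hM6' := Nat.le_of_dvd hMpos hM6
  set i := (a + 5 * b) % 6 with hi
  have hcong : a + M - i ≡ b [MOD Nat.gcd M N] := by
    rw [h6, Nat.ModEq]
    omega
  have hlt := Nat.chineseRemainder'_lt_lcm hcong hMpos.ne' hNpos.ne'
  obtain ⟨hs₁, hs₂⟩ := (Nat.chineseRemainder' hcong).2
  refine ⟨i, Nat.mod_lt _ (by norm_num), ?_, (Nat.chineseRemainder' hcong).1, ?_, ?_, ?_⟩
  · rw [Nat.odd_iff] at hab ⊢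
    omega
  · rwa [Nat.lcm, h6] at hlt
  · rw [← pow_add]
    have h := hs₁.add_right i
    have h' : a + M - i + i = a + M := by omega
    rw [h'] at h
    exact (pow_eq_pow_of_modEq (h.trans Nat.add_modEq_right)
      (hγ ▸ pow_orderOf_eq_one γ)).symm
  · exact (pow_eq_pow_of_modEq hs₂ (hδ ▸ pow_orderOf_eq_one δ)).symm

theorem twoPrimeSign_eq_ite (x : F × K) :
    twoPrimeSign x = if (x.1 = 0 ∧ x.2 ≠ 0) ∨ quadraticChar F x.1 * quadraticChar K x.2 = -1
      then -1 else 1 := by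
  obtain ⟨x, y⟩ := x
  by_cases hx : x = 0
  · by_cases hy : y = 0 <;> simp [twoPrimeSign, hx, hy]
  · by_cases hy : y = 0
    · simp [twoPrimeSign, hx, hy]
    · rcases quadraticChar_dichotomy hx with h | h <;>
        rcases quadraticChar_dichotomy hy with h' | h' <;>
        simp only [twoPrimeSign, hx, hy, h, h'] <;> norm_num

end TwoPrime

theorem stmt_8
    (n₁ n₂ n e g u : ℕ)
    (hp₁ : n₁.Prime) (hp₂ : n₂.Prime)
    (hodd₁ : Odd n₁) (hodd₂ : Odd n₂) (hne : n₁ ≠ n₂)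
    (h6 : Nat.gcd (n₁ - 1) (n₂ - 1) = 6)
    (hn : n = n₁ * n₂)
    (he : e = (n₁ - 1) * (n₂ - 1) / 6)
    (hg₁ : orderOf (g : ZMod n₁) = n₁ - 1)
    (hg₂ : orderOf (g : ZMod n₂) = n₂ - 1)
    (hu₁ : (u : ZMod n₁) = (g : ZMod n₁))
    (hu₂ : (u : ZMod n₂) = 1)
    (W : ℕ → Set (ZMod n))
    (hW : ∀ i, W i = {x | ∃ s < e, x = (g : ZMod n) ^ s * (u : ZMod n) ^ i})
    (P Q : Set (ZMod n))
    (hP : P = {x | ∃ k : ℕ, 1 ≤ k ∧ k ≤ n₂ - 1 ∧ x = ((k * n₁ : ℕ) : ZMod n)})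
    (hQ : Q = {x | ∃ k : ℕ, 1 ≤ k ∧ k ≤ n₁ - 1 ∧ x = ((k * n₂ : ℕ) : ZMod n)})
    (C₁ : Set (ZMod n)) (hC₁ : C₁ = P ∪ W 1 ∪ W 3 ∪ W 5)
    (lam : ℕ → ℤ)
    (hlam : ∀ i : ℕ, ((i : ZMod n) ∈ C₁ → lam i = 1) ∧ ((i : ZMod n) ∉ C₁ → lam i = 0))
    (hodd : Odd ((n₁ - 1) * (n₂ - 1) / 36)) :
    ∀ w : ℕ, 0 < w → w ≤ n - 1 →
      (((w : ZMod n) ∈ P →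
        (1 / (n : ℚ)) * ∑ i ∈ Finset.range n, (-1 : ℚ) ^ (lam (i + w) + lam i)
          = ((n₂ : ℚ) - n₁ - 3) / n) ∧
      ((w : ZMod n) ∈ Q →
        (1 / (n : ℚ)) * ∑ i ∈ Finset.range n, (-1 : ℚ) ^ (lam (i + w) + lam i)
          = ((n₁ : ℚ) + 1 - n₂) / n) ∧
      ((w : ZMod n) ∈ W 0 ∪ W 2 ∪ W 4 →
        (1 / (n : ℚ)) * ∑ i ∈ Finset.range n, (-1 : ℚ) ^ (lam (i + w) + lam i)
          = 1 / n) ∧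
      ((w : ZMod n) ∈ W 1 ∪ W 3 ∪ W 5 →
        (1 / (n : ℚ)) * ∑ i ∈ Finset.range n, (-1 : ℚ) ^ (lam (i + w) + lam i)
          = -3 / n)) := by
  subst hn
  have : Fact n₁.Prime := ⟨hp₁⟩
  have : Fact n₂.Prime := ⟨hp₂⟩
  have hcop : Nat.Coprime n₁ n₂ := (Nat.coprime_primes hp₁ hp₂).mpr hne
  have hnpos : 0 < n₁ * n₂ := Nat.mul_pos hp₁.pos hp₂.pos
  have : NeZero (n₁ * n₂) := ⟨hnpos.ne'⟩
  have hF : ringChar (ZMod n₁) ≠ 2 := by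
    rw [ZMod.ringChar_zmod_n]; rintro rfl; exact absurd hodd₁ (by decide)
  have hK : ringChar (ZMod n₂) ≠ 2 := by
    rw [ZMod.ringChar_zmod_n]; rintro rfl; exact absurd hodd₂ (by decide)
  have hcF : Fintype.card (ZMod n₁) = n₁ := ZMod.card n₁
  have hcK : Fintype.card (ZMod n₂) = n₂ := ZMod.card n₂
  let φ := ZMod.chineseRemainder hcop
  have hφ : ∀ k : ℕ, φ (k : ZMod (n₁ * n₂)) = ((k : ZMod n₁), (k : ZMod n₂)) := fun k => by
    rw [map_natCast]; rfl
  have hχγ₁ := quadraticChar_eq_neg_one_of_orderOf hF (hg₁.trans (by rw [hcF]))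
  have hχγ₂ := quadraticChar_eq_neg_one_of_orderOf hK (hg₂.trans (by rw [hcK]))
  have hW1 : ∀ i (x : ZMod (n₁ * n₂)), x ∈ W i →
      quadraticChar (ZMod n₁) (φ x).1 * quadraticChar (ZMod n₂) (φ x).2 = (-1) ^ i := by
    intro i x hx
    rw [hW] at hx
    obtain ⟨s, -, rfl⟩ := hx
    rw [map_mul, map_pow, map_pow, hφ, hφ, hu₁, hu₂]
    simp only [Prod.fst_mul, Prod.snd_mul, Prod.pow_fst, Prod.pow_snd, map_mul, map_pow, hχγ₁,
      hχγ₂, one_pow, mul_one]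
    rw [mul_right_comm, ← mul_pow]
    norm_num
  have hP_coords : ∀ x : ZMod (n₁ * n₂), x ∈ P ↔ (φ x).1 = 0 ∧ (φ x).2 ≠ 0 := by
    intro x
    rw [hP]
    constructor
    · rintro ⟨k, hk, hk', rfl⟩
      rw [hφ]
      refine ⟨by simp, ?_⟩
      rw [Ne, ZMod.natCast_eq_zero_iff, hcop.symm.dvd_mul_right]
      exact Nat.not_dvd_of_pos_of_lt hk (by have := hp₂.pos; omega)
    · rintro ⟨h₁, h₂⟩
      rw [← ZMod.natCast_zmod_val x, hφ] at h₁ h₂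
      obtain ⟨k, hk⟩ := (ZMod.natCast_eq_zero_iff _ _).mp h₁
      have hlt := x.val_lt
      rw [hk] at hlt h₂
      refine ⟨k, Nat.one_le_iff_ne_zero.mpr ?_, ?_, ?_⟩
      · rintro rfl
        simp at h₂
      · exact Nat.le_sub_one_of_lt (Nat.lt_of_mul_lt_mul_left hlt)
      · exact (ZMod.natCast_zmod_val x).symm.trans (by rw [hk, mul_comm n₁ k])
  have hQ_coords : ∀ x : ZMod (n₁ * n₂), x ∈ Q → (φ x).1 ≠ 0 ∧ (φ x).2 = 0 := by
    intro x hx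
    rw [hQ] at hx
    obtain ⟨k, hk, hk', rfl⟩ := hx
    rw [hφ]
    refine ⟨?_, by simp⟩
    rw [Ne, ZMod.natCast_eq_zero_iff, hcop.dvd_mul_right]
    exact Nat.not_dvd_of_pos_of_lt hk (by have := hp₁.pos; omega)
  have hC : ∀ x : ZMod (n₁ * n₂), x ∈ C₁ ↔ ((φ x).1 = 0 ∧ (φ x).2 ≠ 0) ∨
      quadraticChar (ZMod n₁) (φ x).1 * quadraticChar (ZMod n₂) (φ x).2 = -1 := by
    intro x
    rw [hC₁]
    simp only [Set.mem_union, hP_coords]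
    constructor
    · rintro (((h | h) | h) | h)
      · exact Or.inl h
      · exact Or.inr (hW1 1 x h)
      · exact Or.inr (hW1 3 x h)
      · exact Or.inr (hW1 5 x h)
    · rintro (h | h)
      · exact Or.inl (Or.inl (Or.inl h))
      · obtain ⟨i, hi, hio, s, hs, h₁, h₂⟩ := exists_pow_mul_pow_of_char_mul_eq_neg_one hF hK
          (by rw [hcF, hcK]; exact h6) (hg₁.trans (by rw [hcF])) (hg₂.trans (by rw [hcK])) h
        have hmem : x ∈ W i := by
          rw [hW]
          refine ⟨s, by rwa [hcF, hcK, ← he] at hs, φ.injective ?_⟩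
          rw [map_mul, map_pow, map_pow, hφ, hφ, hu₁, hu₂]
          ext
          · simpa using h₁
          · simpa using h₂
        interval_cases i
        · exact absurd hio (by decide)
        · exact Or.inl (Or.inl (Or.inr hmem))
        · exact absurd hio (by decide)
        · exact Or.inl (Or.inr hmem)
        · exact absurd hio (by decide)
        · exact Or.inr hmem
  have hsign : ∀ i : ℕ, (-1 : ℚ) ^ lam i = (twoPrimeSign (φ (i : ZMod (n₁ * n₂))) : ℤ) := by
    intro i
    rw [twoPrimeSign_eq_ite]
    by_cases h : (i : ZMod (n₁ * n₂)) ∈ C₁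
    · rw [(hlam i).1 h, if_pos ((hC _).mp h)]; norm_num
    · rw [(hlam i).2 h, if_neg (mt (hC _).mpr h)]; norm_num
  have hmod : n₁ % 4 = 3 ∧ n₂ % 4 = 3 := by
    obtain ⟨a, ha⟩ : 6 ∣ n₁ - 1 := h6 ▸ Nat.gcd_dvd_left _ _
    obtain ⟨b, hb⟩ : 6 ∣ n₂ - 1 := h6 ▸ Nat.gcd_dvd_right _ _
    rw [ha, hb, show 6 * a * (6 * b) = a * b * 36 by ring, Nat.mul_div_cancel _ (by norm_num),
      Nat.odd_mul] at hodd
    obtain ⟨⟨c, rfl⟩, ⟨d, rfl⟩⟩ := hodd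
    omega
  have hneg₁ : quadraticChar (ZMod n₁) (-1) = -1 := by
    rw [quadraticChar_neg_one hF, hcF, ZMod.χ₄_nat_three_mod_four hmod.1]
  have hneg₂ : quadraticChar (ZMod n₂) (-1) = -1 := by
    rw [quadraticChar_neg_one hK, hcK, ZMod.χ₄_nat_three_mod_four hmod.2]
  intro w _ _
  have hsum : ∑ i ∈ range (n₁ * n₂), (-1 : ℚ) ^ (lam (i + w) + lam i)
      = ((∑ x : ZMod n₁ × ZMod n₂, twoPrimeSign (x + φ (w : ZMod (n₁ * n₂))) * twoPrimeSign x : ℤ)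
        : ℚ) := by
    rw [← Equiv.sum_comp φ.toEquiv, sum_range, Int.cast_sum]
    refine Fintype.sum_bijective (fun i : Fin (n₁ * n₂) => ((i : ℕ) : ZMod (n₁ * n₂))) ?_ _ _ ?_
    · rw [Fintype.bijective_iff_surjective_and_card]
      refine ⟨fun x => ⟨⟨x.val, x.val_lt⟩, ZMod.natCast_zmod_val x⟩, ?_⟩
      rw [Fintype.card_fin, ZMod.card]
    · intro i
      rw [zpow_add₀ (by norm_num), hsign, hsign]
      push_cast
      rw [map_add φ]
      rfl
  rw [hsum, sum_twoPrimeSign_mul_shift hF hK, hcF, hcK]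
  have hn0 : ((n₁ * n₂ : ℕ) : ℚ) ≠ 0 := by exact_mod_cast hnpos.ne'
  generalize hz : φ (w : ZMod (n₁ * n₂)) = z
  have hunit : ∀ ε : ℤ, ε ≠ 0 → quadraticChar (ZMod n₁) z.1 * quadraticChar (ZMod n₂) z.2 = ε →
      (∑ x, quadraticChar (ZMod n₁) x * quadraticChar (ZMod n₁) (x + z.1)) *
        (∑ x, quadraticChar (ZMod n₂) x * quadraticChar (ZMod n₂) (x + z.2))
      + quadraticChar (ZMod n₁) z.1 * quadraticChar (ZMod n₂) z.2
      + quadraticChar (ZMod n₁) (-z.1) * quadraticChar (ZMod n₂) (-z.2)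
      + (if z.2 = 0 then (n₁ : ℤ) + 2 else 0)
      + (if z.1 = 0 then (n₂ : ℤ) - 2 else 0) - 2
      + (if z.1 = 0 then 1 else 0) * (if z.2 = 0 then 1 else 0) = 2 * ε - 1 := by
    intro ε hε h
    have h₁ : z.1 ≠ 0 := by rintro h'; simp [h'] at h; exact hε h.symm
    have h₂ : z.2 ≠ 0 := by rintro h'; simp [h'] at h; exact hε h.symm
    rw [sum_quadraticChar_mul_shift hF h₁, sum_quadraticChar_mul_shift hK h₂,
      neg_eq_neg_one_mul z.1, neg_eq_neg_one_mul z.2, map_mul, map_mul, hneg₁, hneg₂]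
    simp only [h₁, h₂, if_false]
    linear_combination 2 * h
  refine ⟨fun h => ?_, fun h => ?_, fun h => ?_, fun h => ?_⟩
  · obtain ⟨h₁, h₂⟩ := (hP_coords _).mp h
    rw [hz] at h₁ h₂
    simp only [h₁, h₂, sum_quadraticChar_mul_shift hK h₂, add_zero, sum_quadraticChar_mul_self, hcF,
      neg_zero, MulChar.map_zero, if_true, if_false]
    push_cast
    field_simp
    ring
  · obtain ⟨h₁, h₂⟩ := hQ_coords _ h
    rw [hz] at h₁ h₂
    simp only [h₁, h₂, sum_quadraticChar_mul_shift hF h₁, add_zero, sum_quadraticChar_mul_self, hcK,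
      neg_zero, MulChar.map_zero, if_true, if_false]
    push_cast
    field_simp
    ring
  · rw [hunit 1 (by norm_num)]
    · norm_num
    · rw [← hz]
      rcases h with (h | h) | h
      · exact hW1 0 _ h
      · exact (hW1 2 _ h).trans (by norm_num)
      · exact (hW1 4 _ h).trans (by norm_num)
  · rw [hunit (-1) (by norm_num)]
    · norm_num
      ring
    · rw [← hz]
      rcases h with (h | h) | h
      · exact hW1 1 _ h
      · exact (hW1 3 _ h).trans (by norm_num)
      · exact (hW1 5 _ h).trans (by norm_num)
end

section
/- For every 0 ≤ j ≤ 5 and every t ∈ ℤ/nℤ: if t ∈ P then Σ_{i∈W_j} β^{it} equals the image of the integer −(n₁−1)/6 in GF(q^m), and if t ∈ Q then Σ_{i∈W_j} β^{it} equals the image of the integer −(n₂−1)/6 in GF(q^m). -/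
theorem IsPrimitiveRoot.pow_eq_pow_val_natCast {M : Type*} [CommMonoid M] {ζ : M} {r : ℕ}
    (hζ : IsPrimitiveRoot ζ r) (N : ℕ) : ζ ^ N = ζ ^ (N : ZMod r).val := by
  rw [ZMod.val_natCast, hζ.eq_orderOf, pow_mod_orderOf]

theorem ZMod.ne_zero_of_orderOf_eq {r : ℕ} (hr : r.Prime) {g : ZMod r}
    (hg : orderOf g = r - 1) : g ≠ 0 := by
  have := Fact.mk hr
  rintro rfl
  have h := pow_orderOf_eq_one (0 : ZMod r)
  rw [hg, zero_pow (Nat.sub_pos_of_lt hr.one_lt).ne'] at h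
  exact zero_ne_one h

theorem ZMod.injOn_pow_mul_range {r : ℕ} [Fact r.Prime] {g c : ZMod r}
    (hg : orderOf g = r - 1) (hc : c ≠ 0) :
    Set.InjOn (fun s => g ^ s * c) (Finset.range (r - 1) : Finset ℕ) := by
  intro s hs s' hs' h
  rw [Finset.coe_range, Set.mem_Iio, ← hg] at hs hs'
  exact pow_injOn_Iio_orderOf hs hs' (mul_right_cancel₀ hc h)

/-- The powers of a primitive root modulo `r`, times a unit, run over all nonzero residues. -/
theorem ZMod.image_pow_mul_eq_erase_zero {r : ℕ} [Fact r.Prime] {g c : ZMod r}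
    (hg : orderOf g = r - 1) (hc : c ≠ 0) :
    (Finset.range (r - 1)).image (fun s => g ^ s * c) = Finset.univ.erase 0 := by
  have hg0 := ZMod.ne_zero_of_orderOf_eq Fact.out hg
  apply Finset.eq_of_subset_of_card_le
  · intro x hx
    obtain ⟨s, -, rfl⟩ := Finset.mem_image.mp hx
    exact Finset.mem_erase.mpr ⟨mul_ne_zero (pow_ne_zero _ hg0) hc, Finset.mem_univ _⟩
  · rw [Finset.card_image_of_injOn (ZMod.injOn_pow_mul_range hg hc),
      Finset.card_erase_of_mem (Finset.mem_univ _),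
      Finset.card_univ, ZMod.card, Finset.card_range]

theorem IsPrimitiveRoot.sum_range_pow_primitive_root {F : Type*} [Field F] {r : ℕ}
    (hr : r.Prime) {g c : ℕ} (hg : orderOf (g : ZMod r) = r - 1) (hc : (c : ZMod r) ≠ 0)
    {ζ : F} (hζ : IsPrimitiveRoot ζ r) :
    ∑ s ∈ Finset.range (r - 1), ζ ^ (g ^ s * c) = -1 := by
  have := Fact.mk hr
  have h₁ : ∑ s ∈ Finset.range (r - 1), ζ ^ (g ^ s * c) =
      ∑ x ∈ Finset.univ.erase (0 : ZMod r), ζ ^ x.val := by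
    rw [← ZMod.image_pow_mul_eq_erase_zero hg hc,
      Finset.sum_image (ZMod.injOn_pow_mul_range hg hc)]
    refine Finset.sum_congr rfl fun s _ => ?_
    rw [hζ.pow_eq_pow_val_natCast]
    push_cast
    rfl
  have h₂ : ∑ x : ZMod r, ζ ^ x.val = 0 := by
    rw [← hζ.geom_sum_eq_zero hr.one_lt]
    refine Finset.sum_bij (fun x _ => x.val) (fun x _ => Finset.mem_range.mpr x.val_lt)
      (fun x _ y _ h => ZMod.val_injective r h) (fun b hb => ?_) (fun _ _ => rfl)
    exact ⟨b, Finset.mem_univ _, ZMod.val_cast_of_lt (Finset.mem_range.mp hb)⟩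
  rw [h₁, eq_neg_iff_add_eq_zero, ← h₂, ← Finset.sum_erase_add _ _ (Finset.mem_univ (0 : ZMod r))]
  simp

theorem IsPrimitiveRoot.sum_range_mul_pow_primitive_root {F : Type*} [Field F] {r : ℕ}
    (hr : r.Prime) {g c : ℕ} (hg : orderOf (g : ZMod r) = r - 1) (hc : (c : ZMod r) ≠ 0)
    {ζ : F} (hζ : IsPrimitiveRoot ζ r) (A : ℕ) :
    ∑ s ∈ Finset.range (A * (r - 1)), ζ ^ (g ^ s * c) = -(A : F) := by
  induction A with
  | zero => simp
  | succ A ih =>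
    have hper : ∀ s, ζ ^ (g ^ (A * (r - 1) + s) * c) = ζ ^ (g ^ s * c) := by
      intro s
      rw [hζ.pow_eq_pow_val_natCast, hζ.pow_eq_pow_val_natCast (g ^ s * c)]
      push_cast
      rw [pow_add, mul_comm A, pow_mul, ← hg, pow_orderOf_eq_one, one_pow, one_mul]
    rw [add_mul, one_mul, Finset.sum_range_add, ih, Finset.sum_congr rfl fun s _ => hper s,
      hζ.sum_range_pow_primitive_root hr hg hc]
    push_cast
    ring

/-- Sums of powers of a root of unity of order a product of two primes, over whole periods of a
primitive root `g` modulo the prime `r`, at exponents that are multiples of the other prime. -/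
theorem IsPrimitiveRoot.sum_range_pow_val_mul {F : Type*} [Field F] {n r r' : ℕ}
    (hr : r.Prime) (hr' : r'.Prime) (hn : n = r' * r) {g u : ℕ}
    (hg : orderOf (g : ZMod r) = r - 1) (hu : (u : ZMod r) ≠ 0)
    {β : F} (hβ : IsPrimitiveRoot β n) (A j : ℕ) {k : ℕ} (hk : 1 ≤ k) (hkr : k ≤ r - 1) :
    ∑ s ∈ Finset.range (A * (r - 1)),
      β ^ ((g : ZMod n) ^ s * (u : ZMod n) ^ j * ((k * r' : ℕ) : ZMod n)).val = -(A : F) := by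
  have := Fact.mk hr
  have hζ : IsPrimitiveRoot (β ^ r') r :=
    hβ.pow (by rw [hn]; exact Nat.mul_pos hr'.pos hr.pos) hn
  have hk0 : (k : ZMod r) ≠ 0 := by
    rw [Ne, ZMod.natCast_eq_zero_iff]
    intro h
    have := Nat.le_of_dvd hk h
    lia
  have hc : ((u ^ j * k : ℕ) : ZMod r) ≠ 0 := by
    push_cast
    exact mul_ne_zero (pow_ne_zero _ hu) hk0
  rw [← hζ.sum_range_mul_pow_primitive_root hr hg hc A]
  refine Finset.sum_congr rfl fun s _ => ?_
  rw [← pow_mul, show r' * (g ^ s * (u ^ j * k)) = g ^ s * u ^ j * (k * r') by ring,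
    hβ.pow_eq_pow_val_natCast (g ^ s * u ^ j * (k * r'))]
  push_cast
  rfl

theorem ZMod.modEq_of_pow_mul_pow_eq {n r g u s s' j : ℕ} (hr : r.Prime) (hrn : r ∣ n)
    (hg : orderOf (g : ZMod r) = r - 1) (hu : (u : ZMod r) ≠ 0)
    (h : (g : ZMod n) ^ s * (u : ZMod n) ^ j = (g : ZMod n) ^ s' * (u : ZMod n) ^ j) :
    s ≡ s' [MOD r - 1] := by
  have := Fact.mk hr
  have h' := congrArg (ZMod.castHom hrn (ZMod r)) h
  simp only [map_mul, map_pow, map_natCast] at h'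
  have hgu : IsUnit (g : ZMod r) := (ZMod.ne_zero_of_orderOf_eq hr hg).isUnit
  obtain ⟨v, hv⟩ := hgu
  have h₂ := mul_right_cancel₀ (pow_ne_zero j hu) h'
  rw [← hv] at h₂ hg
  rw [← hg, orderOf_units]
  exact pow_eq_pow_iff_modEq.mp (Units.ext (by push_cast; exact h₂))

theorem stmt_9
    (n₁ n₂ n e g u : ℕ)
    (hp₁ : n₁.Prime) (hp₂ : n₂.Prime)
    (hodd₁ : Odd n₁) (hodd₂ : Odd n₂) (hne : n₁ ≠ n₂)
    (h6 : Nat.gcd (n₁ - 1) (n₂ - 1) = 6)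
    (hn : n = n₁ * n₂)
    (he : e = (n₁ - 1) * (n₂ - 1) / 6)
    (hg₁ : orderOf (g : ZMod n₁) = n₁ - 1)
    (hg₂ : orderOf (g : ZMod n₂) = n₂ - 1)
    (hu₁ : (u : ZMod n₁) = (g : ZMod n₁))
    (hu₂ : (u : ZMod n₂) = 1)
    (W : ℕ → Finset (ZMod n))
    (hW : ∀ i, (W i : Set (ZMod n)) =
      {x | ∃ s < e, x = (g : ZMod n) ^ s * (u : ZMod n) ^ i})
    (P Q : Set (ZMod n))
    (hP : P = {x | ∃ k : ℕ, 1 ≤ k ∧ k ≤ n₂ - 1 ∧ x = ((k * n₁ : ℕ) : ZMod n)})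
    (hQ : Q = {x | ∃ k : ℕ, 1 ≤ k ∧ k ≤ n₁ - 1 ∧ x = ((k * n₂ : ℕ) : ZMod n)})
    (p a q m : ℕ) (hp : p.Prime) (ha : 0 < a) (hq : q = p ^ a)
    (hco : Nat.Coprime n q) (hm : m = orderOf (q : ZMod n))
    (F : Type) [Field F] [Fintype F] [CharP F p]
    (hF : Fintype.card F = q ^ m)
    (β : F) (hβ : IsPrimitiveRoot β n) :
    ∀ j ≤ 5, ∀ t : ZMod n,
      (t ∈ P → ∑ i ∈ W j, β ^ (i * t).val = -(((n₁ - 1) / 6 : ℕ) : F)) ∧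
      (t ∈ Q → ∑ i ∈ W j, β ^ (i * t).val = -(((n₂ - 1) / 6 : ℕ) : F)) := by
  intro j _ t
  have hu₁0 : (u : ZMod n₁) ≠ 0 := hu₁ ▸ ZMod.ne_zero_of_orderOf_eq hp₁ hg₁
  have hu₂0 : (u : ZMod n₂) ≠ 0 := by
    have := Fact.mk hp₂
    rw [hu₂]
    exact one_ne_zero
  have hlcm : Nat.lcm (n₁ - 1) (n₂ - 1) = e := by rw [he, Nat.lcm, h6]
  have hinj : Set.InjOn (fun s => (g : ZMod n) ^ s * (u : ZMod n) ^ j)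
      (Finset.range e : Finset ℕ) := by
    intro s hs s' hs' h
    rw [Finset.coe_range, Set.mem_Iio] at hs hs'
    have h₁ := ZMod.modEq_of_pow_mul_pow_eq hp₁ (hn ▸ Dvd.intro _ rfl) hg₁ hu₁0 h
    have h₂ := ZMod.modEq_of_pow_mul_pow_eq hp₂ (hn ▸ Dvd.intro_left _ rfl) hg₂ hu₂0 h
    have h₃ : s ≡ s' [MOD e] := hlcm ▸ Nat.mod_lcm h₁ h₂
    exact Nat.ModEq.eq_of_lt_of_lt h₃ hs hs'
  have hWj : W j = (Finset.range e).image (fun s => (g : ZMod n) ^ s * (u : ZMod n) ^ j) := by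
    apply Finset.coe_injective
    rw [hW]
    ext x
    simp [eq_comm]
  have h6₁ : 6 ∣ n₁ - 1 := h6 ▸ Nat.gcd_dvd_left _ _
  have h6₂ : 6 ∣ n₂ - 1 := h6 ▸ Nat.gcd_dvd_right _ _
  rw [hWj, Finset.sum_image hinj, hP, hQ]
  constructor
  · rintro ⟨k, hk, hk', rfl⟩
    rw [he, Nat.mul_div_right_comm h6₁]
    exact hβ.sum_range_pow_val_mul hp₂ hp₁ hn hg₂ hu₂0 _ j hk hk'
  · rintro ⟨k, hk, hk', rfl⟩
    rw [he, mul_comm (n₁ - 1), Nat.mul_div_right_comm h6₂]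
    exact hβ.sum_range_pow_val_mul hp₁ hp₂ (hn.trans (mul_comm _ _)) hg₁ hu₁0 _ j hk hk'
end
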